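/- arXiv:2207.09117 — 3 statements merged into one kernel-verified Lean document; each statement's English description precedes it below -/
import Mathlib

section
/- Let X be a set, Y a proper subset of X, and let r, s be elements of the free group F(X) such that: r is a nontrivial cyclically reduced element lying in the subgroup F(Y) generated by Y; s is cyclically reduced, does not lie in F(Y), and there is at least one generator y0 ∈ Y that occurs in r but does not occur in s. Let Z ⊆ Y be the set of generators of Y that occur in s. Then the two homomorphisms φ1 : F(Z) → ⟨Y ∣ r⟩ and φ2 : F(Z) → ⟨(X∖Y) ∪ Z ∣ s⟩ induced by the inclusions of generator sets are both injective, and the presented group G = ⟨X ∣ r, s⟩ is isomorphic to the amalgamated free product (pushout in the category of groups) of ⟨Y ∣ r⟩ and ⟨(X∖Y) ∪ Z ∣ s⟩ along φ1 and φ2, i.e., G ≅ ⟨Y ∣ r⟩ *_{F(Z)} ⟨(X∖Y) ∪ Z ∣ s⟩. -/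
/-- A generator `x` occurs in `w : FreeGroup X` if it appears (with exponent `+1` or `-1`,
encoded by a `Bool`) in the reduced word representing `w`. -/
def OccursIn {X : Type} [DecidableEq X] (x : X) (w : FreeGroup X) : Prop :=
  ∃ b : Bool, (x, b) ∈ w.toWord

/-- `w : FreeGroup X` is cyclically reduced if its reduced word is nonempty and its first
letter is not the inverse of its last letter. -/
def IsCyclicallyReduced {X : Type} [DecidableEq X] (w : FreeGroup X) : Prop :=
  w.toWord ≠ [] ∧
    ∀ p q : X × Bool, w.toWord.head? = some p → w.toWord.getLast? = some q →
      p ≠ (q.1, !q.2)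

namespace FreeGroup

section Support

variable {X : Type*} [DecidableEq X]

theorem mem_closure_of_image_iff {S : Set X} {w : FreeGroup X} :
    w ∈ Subgroup.closure (of '' S) ↔ ∀ a ∈ w.toWord, a.1 ∈ S := by
  constructor
  · intro h
    induction h using Subgroup.closure_induction with
    | mem v hv => obtain ⟨y, hy, rfl⟩ := hv; simpa using hy
    | one => simp
    | mul u v _ _ hu hv =>
      intro a ha
      rcases List.mem_append.1 ((toWord_mul_sublist u v).subset ha) with h | h
      exacts [hu a h, hv a h]
    | inv u _ hu =>
      intro a ha
      rw [toWord_inv] at ha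
      simp only [invRev, List.mem_reverse, List.mem_map] at ha
      obtain ⟨b, hb, rfl⟩ := ha
      exact hu b hb
  · intro h
    rw [← mk_toWord (x := w)]
    generalize w.toWord = L at h
    induction L with
    | nil => exact one_mem _
    | cons a L ih =>
      obtain ⟨y, b⟩ := a
      have hy : of y ∈ Subgroup.closure (of '' S) :=
        Subgroup.subset_closure ⟨y, h (y, b) (by simp), rfl⟩
      rw [← List.singleton_append, ← mul_mk]
      refine mul_mem ?_ (ih fun a ha => h a (by simp [ha]))
      cases b
      · exact inv_mem hy
      · exact hy

theorem countP_toWord_mul_le (q : X × Bool → Bool) (u v : FreeGroup X) :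
    (u * v).toWord.countP q ≤ u.toWord.countP q + v.toWord.countP q := by
  rw [← List.countP_append]
  exact (toWord_mul_sublist u v).countP_le

theorem mem_closure_of_conj_of_isCyclicallyReduced {S : Set X} {r h u : FreeGroup X}
    (hr : IsCyclicallyReduced r.toWord) (hu : u ∈ Subgroup.closure (of '' S))
    (hru : r = h * u * h⁻¹) : r ∈ Subgroup.closure (of '' S) := by
  classical
  rw [mem_closure_of_image_iff]
  by_contra! hcon
  obtain ⟨a, ha, haS⟩ := hcon
  let q : X × Bool → Bool := fun b => decide (b.1 ∉ S)
  have hpos : 1 ≤ r.toWord.countP q := List.countP_pos_iff.2 ⟨a, ha, by simpa [q] using haS⟩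
  set n := h.toWord.countP q + h⁻¹.toWord.countP q + 1 with hn
  have h1 : (r ^ n).toWord.countP q = n * r.toWord.countP q := by
    rw [toWord_pow, (hr.flatten_replicate n).isReduced.reduce_eq]
    simp [List.countP_flatten]
  have h2 : (u ^ n).toWord.countP q = 0 := by
    rw [List.countP_eq_zero]
    intro b hb
    simpa [q] using mem_closure_of_image_iff.1 (pow_mem hu n) b hb
  have h3 : r ^ n = h * u ^ n * h⁻¹ := by rw [hru, conj_pow]
  have h4 := countP_toWord_mul_le q (h * u ^ n) h⁻¹
  have h5 := countP_toWord_mul_le q h (u ^ n)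
  rw [← h3, h1] at h4
  nlinarith

theorem norm_map_le {Y : Type*} [DecidableEq Y] (f : X → Y) (w : FreeGroup X) :
    (map f w).norm ≤ w.norm := by
  rw [← mk_toWord (x := w), map.mk]
  exact norm_mk_le.trans (by simp [norm])

theorem exists_conj_isCyclicallyReduced (u : FreeGroup X) :
    ∃ c v : FreeGroup X, u = c * v * c⁻¹ ∧ IsCyclicallyReduced v.toWord ∧
      v.toWord.Sublist u.toWord := by
  have hu := reduceCyclically.isCyclicallyReduced (isReduced_toWord (x := u))
  have h := reduceCyclically.conj_conjugator_reduceCyclically u.toWord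
  refine ⟨mk (reduceCyclically.conjugator u.toWord), mk (reduceCyclically u.toWord), ?_, ?_, ?_⟩
  · rw [inv_mk, mul_mk, mul_mk, h, mk_toWord]
  · rwa [toWord_mk, hu.isReduced.reduce_eq]
  · rw [toWord_mk, hu.isReduced.reduce_eq]
    conv_rhs => rw [← h]
    exact (List.sublist_append_right _ _).trans (List.sublist_append_left _ _)

end Support

section PGroup

variable {X : Type*} [DecidableEq X]

/-- The exponent sum of the generator `x`. -/
def exponentSum (x : X) : FreeGroup X →* Multiplicative ℤ :=
  lift (Function.update 1 x (Multiplicative.ofAdd 1))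

theorem exponentSum_of_self (x : X) : exponentSum x (of x) = Multiplicative.ofAdd 1 := by
  simp [exponentSum]

theorem exponentSum_of_ne {x y : X} (h : y ≠ x) : exponentSum x (of y) = 1 := by
  simp [exponentSum, h]

theorem lift_update_mul_central {G : Type*} [Group G] (f : X → G) (x : X) (g c : G)
    (hc : c ∈ Subgroup.center G) (w : FreeGroup X) :
    lift (Function.update f x (g * c)) w =
      lift (Function.update f x g) w * c ^ (exponentSum x w).toAdd := by
  have hcomm : ∀ (k : ℤ) (a : G), c ^ k * a = a * c ^ k := fun k a =>
    (Subgroup.mem_center_iff.1 (zpow_mem hc k) a).symm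
  let ψ : FreeGroup X →* G :=
    { toFun := fun v => lift (Function.update f x g) v * c ^ (exponentSum x v).toAdd
      map_one' := by simp
      map_mul' := fun u v => by
        simp only [_root_.map_mul, toAdd_mul, zpow_add]
        rw [mul_assoc, mul_assoc, ← mul_assoc (c ^ _) (lift _ v), hcomm _ (lift _ v), mul_assoc] }
  have : lift (Function.update f x (g * c)) = ψ := by
    ext y
    by_cases hy : y = x
    · subst hy; simp [ψ, exponentSum_of_self]
    · simp [ψ, exponentSum_of_ne hy, hy]
  exact DFunLike.congr_fun this w

theorem exists_lift_update_eq_one {p : ℕ} (hp : p.Prime) (x : X) (r : FreeGroup X)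
    (hr : ¬ (p : ℤ) ∣ (exponentSum x r).toAdd) {P : Type*} [Group P] [Group.IsNilpotent P]
    (hP : IsPGroup p P) (f : X → P) :
    ∃ g, lift (Function.update f x g) r = 1 := by
  revert hP f
  refine Group.nilpotent_center_quotient_ind
    (P := fun P _ _ => IsPGroup p P → ∀ f : X → P,
      ∃ g, lift (Function.update f x g) r = 1) P ?_ ?_
  · intro G _ _ _ f
    exact ⟨1, Subsingleton.elim _ _⟩
  · intro G _ _ ih hG f
    obtain ⟨g', hg'⟩ := ih (hG.to_quotient _) (QuotientGroup.mk' (Subgroup.center G) ∘ f)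
    obtain ⟨g, rfl⟩ := QuotientGroup.mk'_surjective _ g'
    set z := lift (Function.update f x g) r with hz
    have hzc : z ∈ Subgroup.center G := by
      have hcomp : lift (QuotientGroup.mk' (Subgroup.center G) ∘ Function.update f x g) =
          (QuotientGroup.mk' (Subgroup.center G)).comp (lift (Function.update f x g)) := by
        ext; simp
      rw [← Function.comp_update, hcomp] at hg'
      exact (QuotientGroup.eq_one_iff _).1 hg'
    obtain ⟨k, hk⟩ := hG z
    have hcop : IsCoprime (exponentSum x r).toAdd ((p : ℤ) ^ k) :=
      (((Nat.prime_iff_prime_int.1 hp).coprime_iff_not_dvd.2 hr).symm).pow_right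
    obtain ⟨a, b, hab⟩ := hcop
    refine ⟨g * z ^ (-a), ?_⟩
    rw [lift_update_mul_central _ _ _ _ (zpow_mem hzc _), ← hz, ← zpow_mul, ← zpow_one_add]
    have : 1 + -a * (exponentSum x r).toAdd = ((p ^ k : ℕ) : ℤ) * b := by
      push_cast; linarith
    rw [this, zpow_mul, zpow_natCast, hk, one_zpow]

end PGroup

section Unipotent

/-- The matrix `M` vanishes below its `m`-th superdiagonal. -/
def IsUpperBand {R : Type*} [CommRing R] {n : ℕ} (m : ℕ) (M : Matrix (Fin n) (Fin n) R) : Prop :=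
  ∀ i j : Fin n, j.val < i.val + m → M i j = 0

variable {R : Type*} [CommRing R] {n : ℕ}

theorem IsUpperBand.mul {m m' : ℕ} {M M' : Matrix (Fin n) (Fin n) R}
    (h : IsUpperBand m M) (h' : IsUpperBand m' M') : IsUpperBand (m + m') (M * M') := by
  intro i j hij
  rw [Matrix.mul_apply]
  refine Finset.sum_eq_zero fun l _ => ?_
  by_cases hl : l.val < i.val + m
  · rw [h i l hl, zero_mul]
  · rw [h' l j (by omega), mul_zero]

theorem IsUpperBand.add {m : ℕ} {M M' : Matrix (Fin n) (Fin n) R}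
    (h : IsUpperBand m M) (h' : IsUpperBand m M') : IsUpperBand m (M + M') := by
  intro i j hij
  rw [Matrix.add_apply, h i j hij, h' i j hij, add_zero]

theorem IsUpperBand.mono {m m' : ℕ} {M : Matrix (Fin n) (Fin n) R}
    (h : IsUpperBand m M) (hm : m' ≤ m) : IsUpperBand m' M :=
  fun i j hij => h i j (by omega)

theorem isUpperBand_one : IsUpperBand 0 (1 : Matrix (Fin n) (Fin n) R) := by
  intro i j hij
  exact Matrix.one_apply_ne (by rintro rfl; omega)

theorem IsUpperBand.pow {M : Matrix (Fin n) (Fin n) R} (h : IsUpperBand 1 M) (k : ℕ) :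
    IsUpperBand k (M ^ k) := by
  induction k with
  | zero => simpa using isUpperBand_one
  | succ k ih => rw [pow_succ]; exact ih.mul h

variable (R n) in
/-- The group of upper unitriangular matrices. -/
def unitriangular : Subgroup (Matrix (Fin n) (Fin n) R)ˣ where
  carrier := {u | IsUpperBand 1 (u.val - 1) ∧ IsUpperBand 1 (u⁻¹.val - 1)}
  one_mem' := by
    have : IsUpperBand 1 (0 : Matrix (Fin n) (Fin n) R) := fun _ _ _ => rfl
    simpa using this
  inv_mem' := fun {u} h => ⟨h.2, by simpa using h.1⟩
  mul_mem' := by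
    have key : ∀ a b : Matrix (Fin n) (Fin n) R, IsUpperBand 1 (a - 1) → IsUpperBand 1 (b - 1) →
        IsUpperBand 1 (a * b - 1) := by
      intro a b ha hb
      have : a * b - 1 = (a - 1) * (b - 1) + (a - 1) + (b - 1) := by noncomm_ring
      rw [this]
      exact (((ha.mul hb).mono (by omega)).add ha).add hb
    rintro u v ⟨hu, hu'⟩ ⟨hv, hv'⟩
    refine ⟨key _ _ hu hv, ?_⟩
    rw [mul_inv_rev]
    exact key _ _ hv' hu'

theorem isPGroup_unitriangular {p : ℕ} [Fact p.Prime] [CharP R p] :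
    IsPGroup p (unitriangular R n) := by
  rintro ⟨u, hu, -⟩
  rcases n.eq_zero_or_pos with rfl | hn
  · exact ⟨0, Subsingleton.elim _ _⟩
  have : Nonempty (Fin n) := ⟨⟨0, hn⟩⟩
  refine ⟨n, Subtype.ext (Units.ext ?_)⟩
  have hzero : (u.val - 1) ^ p ^ n = 0 := by
    ext i j
    refine (hu.pow (p ^ n)) i j ?_
    have := (Nat.lt_pow_self (Fact.out : p.Prime).one_lt : n < p ^ n)
    omega
  have hadd := add_pow_char_pow_of_commute p n (Commute.one_right (u.val - 1))
  rw [hzero, sub_add_cancel] at hadd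
  simpa using hadd

/-- For `N ^ 2 = 0`, the one-parameter group `k ↦ 1 + k N`. -/
def oneAddUnit {A : Type*} [Ring A] (N : A) (hN : N * N = 0) : Aˣ where
  val := 1 + N
  inv := 1 - N
  val_inv := by rw [← sub_eq_zero]; noncomm_ring; simp [hN]
  inv_val := by rw [← sub_eq_zero]; noncomm_ring; simp [hN]

theorem val_oneAddUnit_zpow {A : Type*} [Ring A] (N : A) (hN : N * N = 0) (k : ℤ) :
    ((oneAddUnit N hN ^ k : Aˣ) : A) = 1 + k * N := by
  have hk : ∀ a : ℤ, (a : A) * N * N = 0 := fun a => by rw [mul_assoc, hN, mul_zero]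
  induction k using Int.induction_on with
  | zero => simp
  | succ i ih =>
    rw [zpow_add_one, Units.val_mul, ih]
    simp only [oneAddUnit, mul_add, add_mul, hk]
    push_cast
    noncomm_ring
  | pred i ih =>
    rw [zpow_sub_one, Units.val_mul, ih]
    simp only [oneAddUnit, Units.inv_mk, mul_sub, add_mul, hk]
    push_cast
    noncomm_ring

end Unipotent

section Residual

variable {X : Type*} [DecidableEq X]

theorem exists_syllables (w : FreeGroup X) :
    ∃ S : List (X × ℤ), S.IsChain (fun a b => a.1 ≠ b.1) ∧ (∀ a ∈ S, a.2 ≠ 0) ∧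
      w = (S.map fun a => of a.1 ^ a.2).prod := by
  rw [← mk_toWord (x := w)]
  induction w.toWord with
  | nil => exact ⟨[], by simp, by simp, rfl⟩
  | cons a L ih =>
    obtain ⟨S, hS, hne, hL⟩ := ih
    obtain ⟨y, b⟩ := a
    obtain ⟨ε, hε, hy⟩ : ∃ ε : ℤ, ε ≠ 0 ∧ mk [(y, b)] = of y ^ ε := by
      cases b
      · exact ⟨-1, by simp, by simp [of, inv_mk, invRev]⟩
      · exact ⟨1, by simp, by simp [of]⟩
    rw [← List.singleton_append, ← mul_mk, hL, hy]
    cases S with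
    | nil => exact ⟨[(y, ε)], by simp, by simpa using hε, by simp⟩
    | cons c S =>
      obtain ⟨z, e⟩ := c
      by_cases hyz : y = z
      · subst hyz
        by_cases he : ε + e = 0
        · refine ⟨S, hS.tail, fun a ha => hne a (by simp [ha]), ?_⟩
          simp [← mul_assoc, ← zpow_add, he]
        · refine ⟨(y, ε + e) :: S, ?_, ?_, ?_⟩
          · rw [List.isChain_cons] at hS ⊢
            exact hS
          · intro a ha
            rcases List.mem_cons.1 ha with rfl | h
            exacts [he, hne a (by simp [h])]
          · simp [← mul_assoc, ← zpow_add]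
      · refine ⟨(y, ε) :: (z, e) :: S, List.isChain_cons_cons.2 ⟨hyz, hS⟩, ?_, by simp⟩
        intro a ha
        rcases List.mem_cons.1 ha with rfl | h
        exacts [hε, hne a h]

/-- The matrix of the edges labelled `y` in the directed path labelled by `S`. -/
def pathMatrix (R : Type*) [CommRing R] (S : List (X × ℤ)) (y : X) :
    Matrix (Fin (S.length + 1)) (Fin (S.length + 1)) R :=
  fun i j => if j.val = i.val + 1 ∧ S[i.val]?.map Prod.fst = some y then 1 else 0

variable {R : Type*} [CommRing R]

theorem isUpperBand_pathMatrix (S : List (X × ℤ)) (y : X) : IsUpperBand 1 (pathMatrix R S y) := by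
  intro i j hij
  rw [pathMatrix, if_neg (by omega)]

theorem pathMatrix_mul_self {S : List (X × ℤ)} (hS : S.IsChain (fun a b => a.1 ≠ b.1)) (y : X) :
    pathMatrix R S y * pathMatrix R S y = 0 := by
  ext i j
  rw [Matrix.mul_apply]
  refine Finset.sum_eq_zero fun l _ => ?_
  by_contra hne
  have h1 := left_ne_zero_of_mul hne
  have h2 := right_ne_zero_of_mul hne
  simp only [pathMatrix, ne_eq, ite_eq_right_iff, Classical.not_imp] at h1 h2
  obtain ⟨⟨hl, hi⟩, -⟩ := h1
  obtain ⟨⟨hj, hl'⟩, -⟩ := h2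
  rw [hl] at hl'
  have hlt : i.val + 1 < S.length := by have := j.isLt; omega
  rw [List.getElem?_eq_getElem (by omega)] at hi hl'
  simp only [Option.map_some, Option.some.injEq] at hi hl'
  exact List.isChain_iff_getElem.1 hS i.val hlt (hi.trans hl'.symm)

/-- The product of the unipotent matrices attached to the syllables of `T`. -/
def pathProd (R : Type*) [CommRing R] (S T : List (X × ℤ)) :
    Matrix (Fin (S.length + 1)) (Fin (S.length + 1)) R :=
  (T.map fun a => 1 + (a.2 : R) • pathMatrix R S a.1).prod

theorem pathProd_apply_last {S : List (X × ℤ)} (T : List (X × ℤ)) (hT : T <:+ S)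
    (i : Fin (S.length + 1)) (hi : i.val + T.length ≤ S.length) :
    pathProd R S T i (Fin.last _) =
      if i.val + T.length = S.length then (T.map fun a => (a.2 : R)).prod else 0 := by
  induction T generalizing i with
  | nil =>
    simp only [pathProd, List.map_nil, List.prod_nil, List.length_nil, add_zero]
    rw [Matrix.one_apply]
    simp [Fin.ext_iff]
  | cons a T ih =>
    have hT' : T <:+ S := (List.suffix_cons a T).trans hT
    rw [List.length_cons] at hi ⊢
    have hprod : pathProd R S (a :: T) =
        pathProd R S T + (a.2 : R) • (pathMatrix R S a.1 * pathProd R S T) := by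
      simp [pathProd, add_mul]
    have hsucc : i.val + 1 < S.length + 1 := by omega
    rw [hprod, Matrix.add_apply, ih hT' i (by omega), if_neg (by omega), zero_add,
      Matrix.smul_apply, Matrix.mul_apply, Finset.sum_eq_single ⟨i.val + 1, hsucc⟩,
      ih hT' ⟨i.val + 1, hsucc⟩ (by simp only; omega)]
    · by_cases h : i.val + (T.length + 1) = S.length
      · obtain ⟨S', rfl⟩ := hT
        have hi' : i.val = S'.length := by simp at h; omega
        rw [if_pos h, if_pos (by simp only; omega)]
        simp [pathMatrix, hi']
      · rw [if_neg h, if_neg (by simp only; omega), mul_zero, smul_zero]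
    · intro j _ hj
      rw [pathMatrix, if_neg, zero_mul]
      rintro ⟨h, -⟩
      exact hj (Fin.ext h)
    · simp

theorem exists_hom_pGroup_ne_one {w : FreeGroup X} (hw : w ≠ 1) :
    ∃ N : ℕ, ∀ p : ℕ, p.Prime → N ≤ p → ∃ (P : Type) (_ : Group P) (_ : Finite P) (f : X → P),
      IsPGroup p P ∧ lift f w ≠ 1 := by
  obtain ⟨S, hS, hne, rfl⟩ := exists_syllables w
  refine ⟨(S.map fun a => a.2.natAbs).sum + 1, fun p hp hNp => ?_⟩
  have : Fact p.Prime := ⟨hp⟩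
  let u : X → (Matrix (Fin (S.length + 1)) (Fin (S.length + 1)) (ZMod p))ˣ := fun y =>
    oneAddUnit (pathMatrix (ZMod p) S y) (pathMatrix_mul_self hS y)
  have hu : ∀ y, u y ∈ unitriangular (ZMod p) (S.length + 1) := by
    intro y
    have h := isUpperBand_pathMatrix (R := ZMod p) S y
    refine ⟨by simpa [u, oneAddUnit] using h, fun i j hij => ?_⟩
    have := h i j hij
    simpa [u, oneAddUnit] using this
  refine ⟨unitriangular (ZMod p) (S.length + 1), inferInstance, inferInstance,
    fun y => ⟨u y, hu y⟩, isPGroup_unitriangular, fun hone => ?_⟩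
  have hval : ((lift (fun y => (⟨u y, hu y⟩ : unitriangular (ZMod p) (S.length + 1)))
      (S.map fun a => of a.1 ^ a.2).prod).val.val) = pathProd (ZMod p) S S := by
    rw [map_list_prod, List.map_map]
    change (Units.coeHom _).comp (unitriangular (ZMod p) (S.length + 1)).subtype _ = _
    rw [map_list_prod, List.map_map, pathProd]
    congr 1
    refine List.map_congr_left fun a _ => ?_
    simp [u, val_oneAddUnit_zpow]
    rw [← zsmul_eq_mul, Int.cast_smul_eq_zsmul]
  rw [hone] at hval
  have hS0 : S ≠ [] := by rintro rfl; exact hw rfl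
  have hlast := pathProd_apply_last (R := ZMod p) S List.suffix_rfl 0 (by simp)
  rw [← hval] at hlast
  simp only [Fin.val_zero, zero_add, if_true] at hlast
  have h0 : (0 : Fin (S.length + 1)) ≠ Fin.last _ := by
    have := List.length_pos_iff.2 hS0
    simp only [ne_eq, Fin.ext_iff, Fin.val_zero, Fin.val_last]
    omega
  have hz : (S.map fun a => (a.2 : ZMod p)).prod = 0 := by
    rw [← hlast]
    exact Matrix.one_apply_ne h0
  obtain ⟨a, ha, ha0⟩ := List.mem_map.1 (List.prod_eq_zero_iff.1 hz)
  rw [ZMod.intCast_zmod_eq_zero_iff_dvd] at ha0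
  have h1 := Int.natAbs_le_of_dvd_ne_zero ha0 (hne a ha)
  have h2 : a.2.natAbs ≤ (S.map fun a => a.2.natAbs).sum :=
    List.single_le_sum (by simp) _ (List.mem_map.2 ⟨a, ha, rfl⟩)
  simp at h1
  omega

end Residual
section Freiheitssatz

universe u

theorem freiheitssatz_of_exponentSum_ne_zero {X : Type u} [DecidableEq X] {r : FreeGroup X} {x : X}
    (hr : (exponentSum x r).toAdd ≠ 0) {w : FreeGroup X}
    (hw : w ∈ Subgroup.closure (of '' {x}ᶜ)) (hwr : w ∈ Subgroup.normalClosure {r}) : w = 1 := by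
  by_contra hne
  obtain ⟨N, hN⟩ := exists_hom_pGroup_ne_one hne
  obtain ⟨p, hNp, hp⟩ := Nat.exists_infinite_primes (N + (exponentSum x r).toAdd.natAbs + 1)
  obtain ⟨P, _, _, f, hP, hfw⟩ := hN p hp (by omega)
  have : Fact p.Prime := ⟨hp⟩
  have : Group.IsNilpotent P := hP.isNilpotent
  have hdvd : ¬ (p : ℤ) ∣ (exponentSum x r).toAdd := fun h => by
    have := Int.natAbs_le_of_dvd_ne_zero h hr
    simp at this
    omega
  obtain ⟨g, hg⟩ := exists_lift_update_eq_one hp x r hdvd hP f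
  have hker : Subgroup.normalClosure {r} ≤ (lift (Function.update f x g)).ker :=
    Subgroup.normalClosure_le_normal (by simpa using hg)
  have heq : Set.EqOn (lift f) (lift (Function.update f x g)) (of '' {x}ᶜ) := by
    rintro _ ⟨y, hy, rfl⟩
    simp [show y ≠ x from hy]
  exact hfw ((MonoidHom.eqOn_closure heq hw).trans (hker hwr))

/-- The homomorphism sending the generator `(z, i)` to the conjugate of `z` by the `i`-th power
of `x`. -/
def conjPow {X : Type u} (x : X) : FreeGroup (X × ℤ) →* FreeGroup X :=
  lift fun a => of x ^ a.2 * of a.1 * (of x ^ a.2)⁻¹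

/-- The automorphism of the free group on `X × ℤ` translating the second index. -/
def shift {X : Type u} : FreeGroup (X × ℤ) →* FreeGroup (X × ℤ) :=
  map fun a => (a.1, a.2 + 1)

theorem exists_conjPow_mul_zpow {X : Type u} [DecidableEq X] (x : X) (L : List (X × Bool)) :
    ∃ (v : FreeGroup (X × ℤ)) (k : ℤ), v ∈ Subgroup.closure (of '' {a | a.1 ≠ x}) ∧
      mk L = conjPow x v * of x ^ k ∧ v.norm ≤ L.countP (fun a => a.1 ≠ x) := by
  have hstep : ∀ (j : ℤ) (v : FreeGroup (X × ℤ)), of x ^ j * conjPow x v =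
      conjPow x (map (fun a => (a.1, a.2 + j)) v) * of x ^ j := by
    intro j v
    rw [← mul_inv_eq_iff_eq_mul]
    have : (MulAut.conj (of x ^ j)).toMonoidHom.comp (conjPow x) =
        (conjPow x).comp (map (fun a => (a.1, a.2 + j))) := by
      ext a
      simp [conjPow, zpow_add, mul_assoc, add_comm _ j, -_root_.map_zpow, -_root_.map_inv]
    exact DFunLike.congr_fun this v
  induction L with
  | nil => exact ⟨1, 0, one_mem _, by simp [← one_eq_mk], by simp⟩
  | cons a L ih =>
    obtain ⟨v, k, hv, hL, hnorm⟩ := ih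
    obtain ⟨y, b⟩ := a
    rw [← List.singleton_append, ← mul_mk, hL]
    by_cases hy : y = x
    · subst hy
      obtain ⟨j, hj⟩ : ∃ j : ℤ, mk [(y, b)] = of y ^ j := by
        cases b
        · exact ⟨-1, by simp [of, inv_mk, invRev]⟩
        · exact ⟨1, by simp [of]⟩
      refine ⟨map (fun a => (a.1, a.2 + j)) v, j + k, ?_, ?_, ?_⟩
      · have : Subgroup.closure (of '' {a : X × ℤ | a.1 ≠ y}) ≤
            (Subgroup.closure (of '' {a : X × ℤ | a.1 ≠ y})).comap
              (map fun a => (a.1, a.2 + j)) := by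
          rw [Subgroup.closure_le]
          rintro _ ⟨c, hc, rfl⟩
          exact Subgroup.subset_closure ⟨(c.1, c.2 + j), hc, by simp⟩
        exact this hv
      · rw [hj, ← mul_assoc, hstep, mul_assoc, zpow_add]
      · refine (norm_map_le _ v).trans (hnorm.trans ?_)
        simp
    · obtain ⟨s, hs, hsn, hsy⟩ : ∃ s ∈ Subgroup.closure (of '' {a : X × ℤ | a.1 ≠ x}),
          s.norm ≤ 1 ∧ conjPow x s = mk [(y, b)] := by
        have hmem : of (y, (0 : ℤ)) ∈ Subgroup.closure (of '' {a : X × ℤ | a.1 ≠ x}) :=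
          Subgroup.subset_closure ⟨(y, 0), hy, rfl⟩
        cases b
        · exact ⟨(of (y, 0))⁻¹, inv_mem hmem, by simp,
            by simp [conjPow, of, inv_mk, invRev]⟩
        · exact ⟨of (y, 0), hmem, by simp, by simp [conjPow, of]⟩
      refine ⟨s * v, k, mul_mem hs hv, by rw [_root_.map_mul, hsy, mul_assoc], ?_⟩
      have := norm_mul_le s v
      simp only [List.singleton_append, List.countP_cons, ne_eq, hy, not_false_eq_true,
        decide_true, if_true] at hnorm ⊢
      omega

theorem exists_conjPow_eq {X : Type u} [DecidableEq X] {x : X} {r : FreeGroup X}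
    (hr : exponentSum x r = 1) (hx : ∃ b, (x, b) ∈ r.toWord) :
    ∃ v : FreeGroup (X × ℤ), v ∈ Subgroup.closure (of '' {a | a.1 ≠ x}) ∧
      conjPow x v = r ∧ v.norm < r.norm := by
  obtain ⟨v, k, hv, hL, hnorm⟩ := exists_conjPow_mul_zpow x r.toWord
  rw [mk_toWord] at hL
  have hle : Subgroup.closure (of '' {a : X × ℤ | a.1 ≠ x}) ≤
      ((exponentSum x).comp (conjPow x)).ker := by
    rw [Subgroup.closure_le]
    rintro _ ⟨a, ha, rfl⟩
    have ha : a.1 ≠ x := ha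
    simp [conjPow, exponentSum_of_ne ha]
  have hv1 : exponentSum x (conjPow x v) = 1 := hle hv
  have hk : k = 0 := by
    rw [hL, _root_.map_mul, hv1, map_zpow, exponentSum_of_self] at hr
    simpa [← ofAdd_zsmul] using hr
  subst hk
  refine ⟨v, hv, by simpa using hL.symm, hnorm.trans_lt ?_⟩
  obtain ⟨b, hb⟩ := hx
  exact List.countP_lt_length_iff.2 ⟨_, hb, by simp⟩

/-- If the two translates of the free subgroup on `{z ≠ x} × [m, M)` embed in the one-relator
group with relator `v`, then `X ∖ {x}` freely generates a subgroup of a group where the relator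
`conjPow x v` dies. -/
theorem freiheitssatz_of_conjPow {X : Type u} [DecidableEq X] {x : X} {v : FreeGroup (X × ℤ)}
    {m M : ℤ} (hmM : m < M)
    (hv : v ∈ Subgroup.closure (of '' {a | a.1 ≠ x ∧ m ≤ a.2 ∧ a.2 ≤ M}))
    (hm : ∀ w ∈ Subgroup.closure (of '' {a : X × ℤ | a.1 ≠ x ∧ m < a.2 ∧ a.2 ≤ M}),
      w ∈ Subgroup.normalClosure {v} → w = 1)
    (hM : ∀ w ∈ Subgroup.closure (of '' {a : X × ℤ | a.1 ≠ x ∧ m ≤ a.2 ∧ a.2 < M}),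
      w ∈ Subgroup.normalClosure {v} → w = 1)
    {w : FreeGroup X} (hw : w ∈ Subgroup.closure (of '' {x}ᶜ))
    (hwr : w ∈ Subgroup.normalClosure {conjPow x v}) : w = 1 := by
  set T : Subgroup (FreeGroup (X × ℤ)) :=
    Subgroup.closure (of '' {a : X × ℤ | a.1 ≠ x ∧ m ≤ a.2 ∧ a.2 < M}) with hT
  let q : FreeGroup (X × ℤ) →* FreeGroup (X × ℤ) ⧸ Subgroup.normalClosure {v} :=
    QuotientGroup.mk' _
  have hq : ∀ g, q g = 1 ↔ g ∈ Subgroup.normalClosure {v} := fun g => QuotientGroup.eq_one_iff g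
  let α := q.comp T.subtype
  let β := (q.comp shift).comp T.subtype
  have hα : Function.Injective α := by
    rw [injective_iff_map_eq_one]
    rintro ⟨g, hg⟩ h
    exact Subtype.ext (hM g hg ((hq g).1 h))
  have hshift : Function.Injective (shift (X := X)) := by
    refine map_injective ?_
    rintro ⟨a, i⟩ ⟨b, j⟩ h
    simpa using h
  have hβ : Function.Injective β := by
    rw [injective_iff_map_eq_one]
    rintro ⟨g, hg⟩ h
    have hle : T ≤ (Subgroup.closure
        (of '' {a : X × ℤ | a.1 ≠ x ∧ m < a.2 ∧ a.2 ≤ M})).comap shift := by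
      rw [hT, Subgroup.closure_le]
      rintro _ ⟨a, ⟨ha, ha', ha''⟩, rfl⟩
      exact Subgroup.subset_closure
        ⟨(a.1, a.2 + 1), ⟨ha, by simp only; omega, by simp only; omega⟩, by simp [shift]⟩
    have h1 := hm _ (hle hg) ((hq _).1 h)
    exact Subtype.ext (hshift (h1.trans (_root_.map_one _).symm))
  let φ : α.range ≃* β.range := (MonoidHom.ofInjective hα).symm.trans (MonoidHom.ofInjective hβ)
  let E := HNNExtension _ α.range β.range φ
  let ι : FreeGroup (X × ℤ) →* E := HNNExtension.of.comp q
  let t : E := HNNExtension.t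
  have ht : ∀ g ∈ T, t * ι g = ι (shift g) * t := by
    intro g hg
    have h := HNNExtension.t_mul_of (φ := φ) (MonoidHom.ofInjective hα ⟨g, hg⟩)
    have h2 : φ (MonoidHom.ofInjective hα ⟨g, hg⟩) = MonoidHom.ofInjective hβ ⟨g, hg⟩ := by
      simp [φ]
    rw [h2] at h
    exact h
  let Ψ : FreeGroup X →* E := lift fun z =>
    if z = x then t else t ^ (-m) * ι (of (z, m)) * (t ^ (-m))⁻¹
  have hΨx : Ψ (of x) = t := by simp [Ψ]
  have hΨ : ∀ z, z ≠ x → Ψ (of z) = t ^ (-m) * ι (of (z, m)) * (t ^ (-m))⁻¹ := fun z hz => by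
    simp [Ψ, hz]
  have hconj : ∀ z, z ≠ x → ∀ k : ℕ, m + k ≤ M →
      t ^ (k : ℤ) * ι (of (z, m)) * (t ^ (k : ℤ))⁻¹ = ι (of (z, m + k)) := by
    intro z hz k
    induction k with
    | zero => simp
    | succ k ih =>
      intro hk
      push_cast at hk
      have h1 := ih (by omega)
      have h2 := ht (of (z, m + k)) (Subgroup.subset_closure
        ⟨_, ⟨hz, by simp only; omega, by simp only; omega⟩, rfl⟩)
      have h3 : ι (of (z, m + (k + 1 : ℕ))) = t * ι (of (z, m + k)) * t⁻¹ := by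
        rw [h2, mul_inv_cancel_right]
        simp [shift, add_assoc]
      rw [h3, ← h1]
      push_cast
      group
  have hvΨ : Ψ (conjPow x v) = ι v := by
    have : Set.EqOn (Ψ.comp (conjPow x)) ι (of '' {a | a.1 ≠ x ∧ m ≤ a.2 ∧ a.2 ≤ M}) := by
      rintro _ ⟨⟨z, i⟩, ⟨hz, hi, hi'⟩, rfl⟩
      simp only at hz hi hi'
      obtain ⟨k, hk⟩ := Int.eq_ofNat_of_zero_le (sub_nonneg.2 hi)
      have hik : i = m + k := by omega
      rw [hik, ← hconj z hz k (by omega)]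
      simp only [conjPow, MonoidHom.coe_comp, Function.comp_apply, lift_apply_of, _root_.map_mul,
        _root_.map_inv, _root_.map_zpow, hΨx, hΨ z hz]
      group
    exact MonoidHom.eqOn_closure this hv
  have hv1 : ι v = 1 := by
    have : q v = 1 := (hq v).2 (Subgroup.subset_normalClosure rfl)
    simp [ι, this]
  have hker : Subgroup.normalClosure {conjPow x v} ≤ Ψ.ker :=
    Subgroup.normalClosure_le_normal (by simp [hvΨ, hv1])
  let j : FreeGroup X →* FreeGroup (X × ℤ) := map fun z => (z, m)
  have hj : Function.Injective j := map_injective fun a b h => by simpa using h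
  have heq : Set.EqOn Ψ ((MulAut.conj (t ^ (-m))).toMonoidHom.comp (ι.comp j)) (of '' {x}ᶜ) := by
    rintro _ ⟨z, hz, rfl⟩
    rw [hΨ z hz]
    simp [j, -_root_.map_zpow, -_root_.map_inv]
  have h1 : t ^ (-m) * ι (j w) * (t ^ (-m))⁻¹ = 1 :=
    ((MonoidHom.eqOn_closure heq hw).symm).trans (hker hwr)
  rw [conj_eq_one_iff] at h1
  have h2 : q (j w) = 1 := HNNExtension.of_injective φ (h1.trans (_root_.map_one _).symm)
  have hle : Subgroup.closure (of '' {x}ᶜ) ≤ T.comap j := by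
    rw [Subgroup.closure_le]
    rintro _ ⟨z, hz, rfl⟩
    exact Subgroup.subset_closure ⟨(z, m), ⟨hz, le_rfl, hmM⟩, by simp [j]⟩
  exact hj ((hM _ (hle hw) ((hq _).1 h2)).trans (_root_.map_one _).symm)

/-- **Magnus' Freiheitssatz**: if `x` occurs in the cyclically reduced relator `r`, the remaining
generators freely generate a subgroup of the one-relator group. -/
theorem freiheitssatz {X : Type u} [DecidableEq X] {r : FreeGroup X}
    (hr : IsCyclicallyReduced r.toWord) {x : X} (hx : ∃ b, (x, b) ∈ r.toWord)
    {w : FreeGroup X} (hw : w ∈ Subgroup.closure (of '' {x}ᶜ))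
    (hwr : w ∈ Subgroup.normalClosure {r}) : w = 1 := by
  induction hn : r.norm using Nat.strong_induction_on generalizing X with
  | _ n ih =>
  subst hn
  by_cases hexp : exponentSum x r = 1
  swap
  · exact freiheitssatz_of_exponentSum_ne_zero hexp hw hwr
  obtain ⟨u, hu, hur, hlt⟩ := exists_conjPow_eq hexp hx
  obtain ⟨c, v, huv, hv, hvu⟩ := exists_conj_isCyclicallyReduced u
  have hvr : v.norm < r.norm := hvu.length_le.trans_lt hlt
  have hvx : ∀ a ∈ v.toWord, a.1.1 ≠ x := fun a ha =>
    mem_closure_of_image_iff.1 hu a (hvu.subset ha)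
  have hrv : r = conjPow x c * conjPow x v * (conjPow x c)⁻¹ := by
    rw [← hur, huv, _root_.map_mul, _root_.map_mul, _root_.map_inv]
  have hne : v.toWord ≠ [] := by
    intro h
    rw [toWord_eq_nil_iff.1 h] at hrv
    have : r = 1 := by simpa using hrv
    obtain ⟨b, hb⟩ := hx
    simp [this] at hb
  obtain ⟨a, ha, hamin⟩ := v.toWord.toFinset.exists_min_image (fun a => a.1.2) (by simpa using hne)
  obtain ⟨b, hb, hbmax⟩ := v.toWord.toFinset.exists_max_image (fun a => a.1.2) (by simpa using hne)
  simp only [List.mem_toFinset] at ha hamin hb hbmax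
  have hvmem : v ∈ Subgroup.closure (of '' {d | d.1 ≠ x ∧ a.1.2 ≤ d.2 ∧ d.2 ≤ b.1.2}) :=
    mem_closure_of_image_iff.2 fun d hd => ⟨hvx d hd, hamin d hd, hbmax d hd⟩
  have hab : a.1.2 < b.1.2 := by
    by_contra hle
    have hmem : (of x ^ a.1.2)⁻¹ * conjPow x v * of x ^ a.1.2 ∈ Subgroup.closure (of '' {x}ᶜ) := by
      have hle' : Subgroup.closure (of '' {d : X × ℤ | d.1 ≠ x ∧ a.1.2 ≤ d.2 ∧ d.2 ≤ b.1.2}) ≤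
          (Subgroup.closure (of '' {x}ᶜ)).comap
            ((MulAut.conj (of x ^ a.1.2)⁻¹).toMonoidHom.comp (conjPow x)) := by
        rw [Subgroup.closure_le]
        rintro _ ⟨d, ⟨hd, hd', hd''⟩, rfl⟩
        have : d.2 = a.1.2 := by omega
        refine Subgroup.subset_closure ⟨d.1, hd, ?_⟩
        simp [conjPow, this, mul_assoc, -_root_.map_zpow, -_root_.map_inv]
      simpa [-_root_.map_zpow, -_root_.map_inv] using hle' hvmem
    have hxr := mem_closure_of_image_iff.1 (mem_closure_of_conj_of_isCyclicallyReduced hr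
      (h := conjPow x c * of x ^ a.1.2) hmem (by rw [hrv]; group))
    obtain ⟨e, he⟩ := hx
    exact hxr _ he rfl
  have key : ∀ d ∈ v.toWord, ∀ S : Set (X × ℤ), d.1 ∉ S → ∀ g ∈ Subgroup.closure (of '' S),
      g ∈ Subgroup.normalClosure {v} → g = 1 := by
    intro d hd S hS g hg hgv
    have hSd : S ⊆ {d.1}ᶜ := Set.subset_compl_singleton_iff.2 hS
    exact ih v.norm hvr hv (x := d.1) ⟨d.2, hd⟩ (Subgroup.closure_mono (Set.image_mono hSd) hg)
      hgv rfl
  have hm := key a ha {d | d.1 ≠ x ∧ a.1.2 < d.2 ∧ d.2 ≤ b.1.2} fun h => lt_irrefl _ h.2.1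
  have hM := key b hb {d | d.1 ≠ x ∧ a.1.2 ≤ d.2 ∧ d.2 < b.1.2} fun h => lt_irrefl _ h.2.2
  refine freiheitssatz_of_conjPow hab hvmem hm hM hw ?_
  have : Subgroup.normalClosure {r} ≤ Subgroup.normalClosure {conjPow x v} := by
    refine Subgroup.normalClosure_le_normal ?_
    rw [Set.singleton_subset_iff, hrv]
    exact Subgroup.normalClosure_normal.conj_mem (conjPow x v)
      (Subgroup.subset_normalClosure (Set.mem_singleton _)) (conjPow x c)
  exact this hwr

theorem injective_toPresentedGroup {X : Type u} [DecidableEq X] {A B : Set X} (hBA : B ⊆ A)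
    {v : FreeGroup X} (hv : IsCyclicallyReduced v.toWord) {x : X} (hxB : x ∉ B)
    (hx : ∃ b, (x, b) ∈ v.toWord) {v' : FreeGroup A} (hv' : map Subtype.val v' = v) :
    Function.Injective (lift fun z : B =>
      (PresentedGroup.of ⟨z.1, hBA z.2⟩ : PresentedGroup ({v'} : Set (FreeGroup A)))) := by
  rw [injective_iff_map_eq_one]
  intro w hw
  have hφ : (lift fun z : B =>
      (PresentedGroup.of ⟨z.1, hBA z.2⟩ : PresentedGroup ({v'} : Set (FreeGroup A)))) =
      (PresentedGroup.mk {v'}).comp (map (Set.inclusion hBA)) := by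
    ext z
    simp [PresentedGroup.of, Set.inclusion]
  rw [hφ, MonoidHom.comp_apply, PresentedGroup.mk_eq_one_iff] at hw
  have hle : Subgroup.normalClosure {v'} ≤
      (Subgroup.normalClosure {v}).comap (map (Subtype.val : A → X)) :=
    Subgroup.normalClosure_le_normal (Set.singleton_subset_iff.2
      (Subgroup.subset_normalClosure hv'))
  have hw' : map Subtype.val w ∈ Subgroup.normalClosure {v} := by
    have := hle hw
    rwa [Subgroup.mem_comap, map.comp] at this
  have hmem : map (Subtype.val : B → X) w ∈ Subgroup.closure (of '' {x}ᶜ) := by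
    have hrange : (⊤ : Subgroup (FreeGroup B)) ≤
        (Subgroup.closure (of '' {x}ᶜ)).comap (map Subtype.val) := by
      rw [← closure_range_of, Subgroup.closure_le]
      rintro _ ⟨z, rfl⟩
      exact Subgroup.subset_closure ⟨z.1, fun h => hxB (h ▸ z.2), map.of.symm⟩
    exact hrange (Subgroup.mem_top w)
  exact map_injective Subtype.val_injective
    ((freiheitssatz hv hx hmem hw').trans (_root_.map_one _).symm)

theorem exists_mem_toWord_notMem {X : Type u} [DecidableEq X] {Y : Set X} {s : FreeGroup X}
    (hs : ∀ w : FreeGroup Y, map Subtype.val w ≠ s) : ∃ x ∉ Y, ∃ b, (x, b) ∈ s.toWord := by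
  by_contra! h
  have hmem : s ∈ Subgroup.closure (of '' Y) :=
    mem_closure_of_image_iff.2 fun a ha => by
      by_contra hY
      exact h a.1 hY a.2 ha
  have hle : Subgroup.closure (of '' Y) ≤ (map (Subtype.val : Y → X)).range := by
    rw [Subgroup.closure_le]
    rintro _ ⟨y, hy, rfl⟩
    exact ⟨of ⟨y, hy⟩, by simp⟩
  obtain ⟨w, hw⟩ := hle hmem
  exact hs w hw

end Freiheitssatz

end FreeGroup

theorem IsCyclicallyReduced.toWord {X : Type} [DecidableEq X] {w : FreeGroup X}
    (h : IsCyclicallyReduced w) : FreeGroup.IsCyclicallyReduced w.toWord := by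
  refine ⟨FreeGroup.isReduced_toWord, fun a ha b hb hab => ?_⟩
  by_contra hne
  refine h.2 b a hb ha (Prod.ext hab.symm ?_)
  cases h1 : a.2 <;> cases h2 : b.2 <;> simp_all

/-- The presentation `⟨X ∣ r, s⟩` has the universal property of the pushout of the presentations
on `Y` and `Yᶜ ∪ Z` along the free group on `Z`. -/
theorem PresentedGroup.exists_isPushout {X : Type} {Y Z : Set X} (hZY : Z ⊆ Y)
    {r s : FreeGroup X}
    {r' : FreeGroup Y} (hr' : FreeGroup.map (Subtype.val : Y → X) r' = r)
    {s' : FreeGroup ↥(Yᶜ ∪ Z)} (hs' : FreeGroup.map (Subtype.val : ↥(Yᶜ ∪ Z) → X) s' = s)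
    {φ₁ : FreeGroup Z →* PresentedGroup ({r'} : Set (FreeGroup Y))}
    (hφ₁ : φ₁ = FreeGroup.lift fun z : Z => .of ⟨z.1, hZY z.2⟩)
    {φ₂ : FreeGroup Z →* PresentedGroup ({s'} : Set (FreeGroup ↥(Yᶜ ∪ Z)))}
    (hφ₂ : φ₂ = FreeGroup.lift fun z : Z => .of ⟨z.1, Set.mem_union_right _ z.2⟩) :
    ∃ (i₁ : PresentedGroup ({r'} : Set (FreeGroup Y)) →* PresentedGroup {r, s})
      (i₂ : PresentedGroup ({s'} : Set (FreeGroup ↥(Yᶜ ∪ Z))) →* PresentedGroup {r, s}),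
      i₁.comp φ₁ = i₂.comp φ₂ ∧
      ∀ (H : Type) [Group H] (f : PresentedGroup ({r'} : Set (FreeGroup Y)) →* H)
        (g : PresentedGroup ({s'} : Set (FreeGroup ↥(Yᶜ ∪ Z))) →* H),
        f.comp φ₁ = g.comp φ₂ →
          ∃! h : PresentedGroup {r, s} →* H, h.comp i₁ = f ∧ h.comp i₂ = g := by
  classical
  have hincl : ∀ {A : Set X} {v' : FreeGroup A},
      FreeGroup.map (Subtype.val : A → X) v' ∈ ({r, s} : Set (FreeGroup X)) →
      ∀ v ∈ ({v'} : Set (FreeGroup A)), FreeGroup.lift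
        (fun a : A => (PresentedGroup.of a.1 : PresentedGroup {r, s})) v = 1 := by
    rintro A v' h v rfl
    have hcomp : FreeGroup.lift (fun a : A => (PresentedGroup.of a.1 : PresentedGroup {r, s})) =
        (PresentedGroup.mk {r, s}).comp (FreeGroup.map Subtype.val) := by
      ext a
      simp [PresentedGroup.of]
    rw [hcomp]
    exact PresentedGroup.one_of_mem h
  subst hφ₁ hφ₂
  refine ⟨PresentedGroup.toGroup (hincl (Or.inl hr')), PresentedGroup.toGroup (hincl (Or.inr hs')),
    by ext z; simp, fun H _ f g hfg => ?_⟩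
  have hZ : ∀ z (hz : z ∈ Z), f (.of ⟨z, hZY hz⟩) = g (.of ⟨z, Or.inr hz⟩) := fun z hz => by
    simpa using DFunLike.congr_fun hfg (FreeGroup.of ⟨z, hz⟩)
  let h₀ : X → H := fun x =>
    if hx : x ∈ Y then f (.of ⟨x, hx⟩) else g (.of ⟨x, Or.inl hx⟩)
  have hf : ∀ y : Y, h₀ y = f (.of y) := fun y => dif_pos y.2
  have hg : ∀ y : ↥(Yᶜ ∪ Z), h₀ y = g (.of y) := by
    rintro ⟨y, hy | hy⟩
    · exact dif_neg hy
    · exact (dif_pos (hZY hy)).trans (hZ y hy)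
  have hrel : ∀ v ∈ ({r, s} : Set (FreeGroup X)), FreeGroup.lift h₀ v = 1 := by
    have hfr : (FreeGroup.lift h₀).comp (FreeGroup.map Subtype.val) =
        f.comp (PresentedGroup.mk {r'}) := by
      ext y
      simpa [PresentedGroup.of] using hf y
    have hgs : (FreeGroup.lift h₀).comp (FreeGroup.map Subtype.val) =
        g.comp (PresentedGroup.mk {s'}) := by
      ext y
      simpa [PresentedGroup.of] using hg y
    rintro v (rfl | rfl)
    · rw [← hr']
      refine (DFunLike.congr_fun hfr r').trans ?_
      rw [MonoidHom.comp_apply, PresentedGroup.one_of_mem (Set.mem_singleton _), map_one]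
    · rw [← hs']
      refine (DFunLike.congr_fun hgs s').trans ?_
      rw [MonoidHom.comp_apply, PresentedGroup.one_of_mem (Set.mem_singleton _), map_one]
  refine ⟨PresentedGroup.toGroup hrel, ⟨?_, ?_⟩, ?_⟩
  · ext y
    simpa using hf y
  · ext y
    simpa using hg y
  · rintro h ⟨rfl, rfl⟩
    ext x
    simp [h₀]


/-- Let `Y ⊊ X`, and `r, s ∈ F(X)` cyclically reduced with `r` nontrivial lying in `F(Y)`
(witnessed by `r'`), `s ∉ F(Y)` missing some generator `y0 ∈ Y` occurring in `r`.  With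
`Z ⊆ Y` the set of generators of `Y` occurring in `s` and `s` lying in `F((X∖Y) ∪ Z)`
(witnessed by `s''`), the natural maps `φ1 : F(Z) → ⟨Y ∣ r⟩` and
`φ2 : F(Z) → ⟨(X∖Y) ∪ Z ∣ s⟩` are injective and `⟨X ∣ r, s⟩` is the pushout (in the
category of groups) of `φ1` and `φ2`, i.e. `⟨X ∣ r,s⟩ ≅ ⟨Y ∣ r⟩ *_{F(Z)} ⟨(X∖Y) ∪ Z ∣ s⟩`. -/
theorem one_relator_amalgam {X : Type} [DecidableEq X] (Y : Set X) (hYproper : Y ≠ Set.univ)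
    (r s : FreeGroup X)
    (r' : FreeGroup ↥Y) (hr' : FreeGroup.map (Subtype.val : ↥Y → X) r' = r)
    (hrne : r ≠ 1) (hrcyc : IsCyclicallyReduced r) (hscyc : IsCyclicallyReduced s)
    (hsY : ∀ w : FreeGroup ↥Y, FreeGroup.map (Subtype.val : ↥Y → X) w ≠ s)
    (y0 : X) (hy0Y : y0 ∈ Y) (hy0r : OccursIn y0 r) (hy0s : ¬ OccursIn y0 s)
    (Z : Set X) (hZ : Z = {y ∈ Y | OccursIn y s}) (hZY : Z ⊆ Y)
    (s'' : FreeGroup ↥((Yᶜ : Set X) ∪ Z))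
    (hs'' : FreeGroup.map (Subtype.val : ↥((Yᶜ : Set X) ∪ Z) → X) s'' = s)
    (φ1 : FreeGroup ↥Z →* PresentedGroup ({r'} : Set (FreeGroup ↥Y)))
    (hφ1 : φ1 = FreeGroup.lift (fun z : ↥Z =>
      (PresentedGroup.of ⟨z.1, hZY z.2⟩ : PresentedGroup ({r'} : Set (FreeGroup ↥Y)))))
    (φ2 : FreeGroup ↥Z →* PresentedGroup ({s''} : Set (FreeGroup ↥((Yᶜ : Set X) ∪ Z))))
    (hφ2 : φ2 = FreeGroup.lift (fun z : ↥Z =>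
      (PresentedGroup.of ⟨z.1, Set.mem_union_right _ z.2⟩ :
        PresentedGroup ({s''} : Set (FreeGroup ↥((Yᶜ : Set X) ∪ Z)))))) :
    Function.Injective φ1 ∧ Function.Injective φ2 ∧
      ∃ (i1 : PresentedGroup ({r'} : Set (FreeGroup ↥Y)) →*
              PresentedGroup ({r, s} : Set (FreeGroup X)))
        (i2 : PresentedGroup ({s''} : Set (FreeGroup ↥((Yᶜ : Set X) ∪ Z))) →*
              PresentedGroup ({r, s} : Set (FreeGroup X))),
        i1.comp φ1 = i2.comp φ2 ∧
        ∀ (H : Type) [Group H]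
          (f : PresentedGroup ({r'} : Set (FreeGroup ↥Y)) →* H)
          (g : PresentedGroup ({s''} : Set (FreeGroup ↥((Yᶜ : Set X) ∪ Z))) →* H),
          f.comp φ1 = g.comp φ2 →
            ∃! h : PresentedGroup ({r, s} : Set (FreeGroup X)) →* H,
              h.comp i1 = f ∧ h.comp i2 = g := by
  obtain ⟨x, hxY, hx⟩ := FreeGroup.exists_mem_toWord_notMem hsY
  have hy0Z : y0 ∉ Z := by
    rw [hZ]
    exact fun h => hy0s h.2
  refine ⟨?_, ?_, PresentedGroup.exists_isPushout hZY hr' hs'' hφ1 hφ2⟩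
  · rw [hφ1]
    exact FreeGroup.injective_toPresentedGroup hZY hrcyc.toWord hy0Z hy0r hr'
  · rw [hφ2]
    exact FreeGroup.injective_toPresentedGroup Set.subset_union_right hscyc.toWord
      (fun h => hxY (hZY h)) hx hs''
end

section
/- Let H be Higman's group, the group presented by ⟨a, b, c, d ∣ a⁻²b⁻¹ab, b⁻²c⁻¹bc, c⁻²d⁻¹cd, d⁻²a⁻¹da⟩, and let G0 be the group presented by ⟨x, y, z ∣ x⁻²y⁻¹xy, y⁻²z⁻¹yz⟩. Let φ1 : F2 → G0 be the homomorphism from the free group on two generators u, v sending u ↦ x and v ↦ z, and let φ2 : F2 → G0 send u ↦ z and v ↦ x. Then φ1 and φ2 are injective, and H is isomorphic to the amalgamated free product (pushout in the category of groups) of two copies of G0 along φ1 and φ2; that is, H ≅ G0 *_{F2} G0, an amalgamated product of two copies of the two-generator-image one-relator-type group G0 over a free subgroup of rank 2. -/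
/-- The relators of Higman's group `⟨a,b,c,d ∣ a⁻²b⁻¹ab, b⁻²c⁻¹bc, c⁻²d⁻¹cd, d⁻²a⁻¹da⟩`,
with generators `a = 0`, `b = 1`, `c = 2`, `d = 3` in `Fin 4`. -/
def higmanRels : Set (FreeGroup (Fin 4)) :=
  { FreeGroup.of 0 ^ (-2 : ℤ) * (FreeGroup.of 1)⁻¹ * FreeGroup.of 0 * FreeGroup.of 1,
    FreeGroup.of 1 ^ (-2 : ℤ) * (FreeGroup.of 2)⁻¹ * FreeGroup.of 1 * FreeGroup.of 2,
    FreeGroup.of 2 ^ (-2 : ℤ) * (FreeGroup.of 3)⁻¹ * FreeGroup.of 2 * FreeGroup.of 3,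
    FreeGroup.of 3 ^ (-2 : ℤ) * (FreeGroup.of 0)⁻¹ * FreeGroup.of 3 * FreeGroup.of 0 }

/-- Higman's group. -/
def Higman : Type := PresentedGroup higmanRels

noncomputable instance : Group Higman := by unfold Higman; infer_instance

/-- The relators of the group `G0 = ⟨x,y,z ∣ x⁻²y⁻¹xy, y⁻²z⁻¹yz⟩`, with generators
`x = 0`, `y = 1`, `z = 2` in `Fin 3`. -/
def g0Rels : Set (FreeGroup (Fin 3)) :=
  { FreeGroup.of 0 ^ (-2 : ℤ) * (FreeGroup.of 1)⁻¹ * FreeGroup.of 0 * FreeGroup.of 1,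
    FreeGroup.of 1 ^ (-2 : ℤ) * (FreeGroup.of 2)⁻¹ * FreeGroup.of 1 * FreeGroup.of 2 }

/-- The group `G0 = ⟨x,y,z ∣ x⁻²y⁻¹xy, y⁻²z⁻¹yz⟩`. -/
def G0 : Type := PresentedGroup g0Rels

noncomputable instance : Group G0 := by unfold G0; infer_instance

/-- `φ1 : F2 → G0`, `u ↦ x`, `v ↦ z` (where `u = 0`, `v = 1` generate `F2 = FreeGroup (Fin 2)`). -/
noncomputable def higmanPhi1 : FreeGroup (Fin 2) →* G0 :=
  FreeGroup.lift (fun i : Fin 2 =>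
    if i = 0 then (PresentedGroup.of (rels := g0Rels) 0 : G0)
    else (PresentedGroup.of (rels := g0Rels) 2 : G0))

/-- `φ2 : F2 → G0`, `u ↦ z`, `v ↦ x`. -/
noncomputable def higmanPhi2 : FreeGroup (Fin 2) →* G0 :=
  FreeGroup.lift (fun i : Fin 2 =>
    if i = 0 then (PresentedGroup.of (rels := g0Rels) 2 : G0)
    else (PresentedGroup.of (rels := g0Rels) 0 : G0))

namespace Monoid.PushoutI

variable {ι H : Type*} {G : ι → Type*} [Group H] [∀ i, Group (G i)] {φ : ∀ i, H →* G i}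

/-- If each `K i` maps injectively to `G i` with image meeting the amalgamated subgroup trivially,
then the free product of the `K i` embeds in the amalgamated product of the `G i`. -/
theorem lift_of_comp_injective {K : ι → Type*} [∀ i, Group (K i)]
    (hφ : ∀ i, Function.Injective (φ i)) (ψ : ∀ i, K i →* G i)
    (hψ : ∀ i k, ψ i k ∈ (φ i).range → k = 1) :
    Function.Injective (CoprodI.lift fun i => (of (φ := φ) i).comp (ψ i)) := by
  classical
  rw [injective_iff_map_eq_one]
  intro x hx
  obtain ⟨w, rfl⟩ := CoprodI.Word.equiv.symm.surjective x
  change CoprodI.lift _ w.prod = 1 at hx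
  change w.prod = 1
  let w' : CoprodI.Word G :=
    { toList := w.toList.map fun l => ⟨l.1, ψ l.1 l.2⟩
      ne_one := by
        simp only [List.mem_map]
        rintro _ ⟨l, hl, rfl⟩ (h : ψ l.1 l.2 = 1)
        exact w.ne_one l hl (hψ _ _ (h ▸ one_mem _))
      chain_ne := (List.isChain_map _).2 w.chain_ne }
  have hprod : ofCoprodI w'.prod = CoprodI.lift (fun i => (of (φ := φ) i).comp (ψ i)) w.prod := by
    simp [w', CoprodI.Word.prod, map_list_prod, Function.comp_def]
  have hred : Reduced φ w' := by
    intro g hg hgr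
    obtain ⟨l, hl, rfl⟩ := List.mem_map.1 hg
    exact w.ne_one l hl (hψ _ _ hgr)
  have hw' := hred.eq_empty_of_mem_range hφ (by rw [hprod, hx]; exact one_mem _)
  have hw : w = .empty := by
    ext1
    exact List.map_eq_nil_iff.1 (congrArg CoprodI.Word.toList hw')
  rw [hw, CoprodI.Word.prod_empty]

/-- Elements of the factors of an amalgamated product, none of whose nontrivial powers lies in the
amalgamated subgroup, freely generate a free group. -/
theorem freeGroup_lift_of_injective (hφ : ∀ i, Function.Injective (φ i)) (g : ∀ i, G i)
    (hg : ∀ i (n : ℤ), g i ^ n ∈ (φ i).range → n = 0) :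
    Function.Injective (FreeGroup.lift fun i => of (φ := φ) i (g i)) := by
  have hcomp : (FreeGroup.lift fun i => of (φ := φ) i (g i)) =
      (CoprodI.lift fun i => (of (φ := φ) i).comp (FreeGroup.lift fun _ : Unit => g i)).comp
        freeGroupEquivCoprodI.toMonoidHom := by
    ext i
    simp
  rw [hcomp, MonoidHom.coe_comp]
  refine (lift_of_comp_injective hφ _ fun i => ?_).comp freeGroupEquivCoprodI.injective
  refine FreeGroup.freeGroupUnitEquivInt.forall_congr_left.mpr fun n hn => ?_
  change FreeGroup.lift (fun _ => g i) (FreeGroup.of () ^ n) ∈ (φ i).range at hn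
  change FreeGroup.of () ^ n = 1
  rw [map_zpow, FreeGroup.lift_apply_of] at hn
  rw [hg i n hn, zpow_zero]

end Monoid.PushoutI

/-- The translation `t ↦ t + 1` of `ℚ`. -/
def ratTranslation : Equiv.Perm ℚ := Equiv.addRight 1

/-- The homothety `t ↦ t / 2` of `ℚ`. -/
def ratHalving : Equiv.Perm ℚ := Equiv.mulRight₀ (1 / 2) (by norm_num)

theorem ratHalving_conj :
    ratTranslation ^ (-2 : ℤ) * ratHalving⁻¹ * ratTranslation * ratHalving = 1 := by
  rw [mul_assoc, mul_assoc, zpow_neg, inv_mul_eq_one, eq_inv_mul_iff_mul_eq]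
  ext t
  simp [ratTranslation, ratHalving, zpow_ofNat, pow_two]
  ring

theorem ratTranslation_zpow_apply (n : ℤ) (t : ℚ) : (ratTranslation ^ n) t = t + n := by
  simp [ratTranslation]

theorem ratHalving_zpow_apply (n : ℤ) (t : ℚ) : (ratHalving ^ n) t = t * (1 / 2) ^ n := by
  induction n with
  | zero => simp
  | succ n ih =>
    rw [add_comm, zpow_add, Equiv.Perm.mul_apply, ih, zpow_add₀ (by norm_num)]
    simp only [zpow_one, ratHalving, Equiv.mulRight₀_apply]
    ring
  | pred n ih =>
    rw [sub_eq_neg_add, zpow_add, Equiv.Perm.mul_apply, ih, zpow_add₀ (by norm_num),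
      zpow_neg_one, Equiv.Perm.inv_eq_iff_eq]
    simp only [ratHalving, Equiv.mulRight₀_apply]
    ring

theorem eq_zero_of_ratTranslation_zpow_eq_ratHalving_zpow {m n : ℤ}
    (h : ratTranslation ^ m = ratHalving ^ n) : m = 0 ∧ n = 0 := by
  have h0 := Equiv.congr_fun h 0
  have h1 := Equiv.congr_fun h 1
  rw [ratTranslation_zpow_apply, ratHalving_zpow_apply] at h0 h1
  have hm : m = 0 := by simpa using h0
  refine ⟨hm, ?_⟩
  have h2 : (1 / 2 : ℚ) ^ n = 1 := by simpa [hm] using h1.symm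
  exact (zpow_eq_one_iff_right₀ (by norm_num) (by norm_num)).1 h2

/-- The two embeddings of `ℤ` in `Equiv.Perm ℚ`, generated by `ratHalving` and `ratTranslation`,
along which two copies of an affine group are amalgamated. -/
def affineAmalgam (i : Fin 2) : Multiplicative ℤ →* Equiv.Perm ℚ :=
  zpowersHom _ (![ratHalving, ratTranslation] i)

theorem affineAmalgam_injective (i : Fin 2) : Function.Injective (affineAmalgam i) := by
  rw [injective_iff_map_eq_one]
  intro n hn
  rw [affineAmalgam, zpowersHom_apply] at hn
  apply Multiplicative.toAdd.injective
  fin_cases i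
  · exact (eq_zero_of_ratTranslation_zpow_eq_ratHalving_zpow (m := 0) hn.symm).2
  · exact (eq_zero_of_ratTranslation_zpow_eq_ratHalving_zpow (n := 0) hn).1

theorem zpow_eq_zero_of_mem_range_affineAmalgam (i : Fin 2) (n : ℤ)
    (h : ![ratTranslation, ratHalving] i ^ n ∈ (affineAmalgam i).range) : n = 0 := by
  obtain ⟨m, hm⟩ := h
  rw [affineAmalgam, zpowersHom_apply] at hm
  fin_cases i
  · exact (eq_zero_of_ratTranslation_zpow_eq_ratHalving_zpow hm.symm).1
  · exact (eq_zero_of_ratTranslation_zpow_eq_ratHalving_zpow hm).2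

namespace G0

/-- The generators `x, y, z` of `G0`. -/
def gen (i : Fin 3) : G0 := PresentedGroup.of (rels := g0Rels) i

theorem relation_zero : gen 0 ^ (-2 : ℤ) * (gen 1)⁻¹ * gen 0 * gen 1 = 1 :=
  PresentedGroup.one_of_mem (rels := g0Rels) (Or.inl rfl)

theorem relation_one : gen 1 ^ (-2 : ℤ) * (gen 2)⁻¹ * gen 1 * gen 2 = 1 :=
  PresentedGroup.one_of_mem (rels := g0Rels) (Or.inr rfl)

variable {K : Type*} [Group K]

theorem exists_hom (x y z : K) (hxy : x ^ (-2 : ℤ) * y⁻¹ * x * y = 1)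
    (hyz : y ^ (-2 : ℤ) * z⁻¹ * y * z = 1) :
    ∃ f : G0 →* K, f (gen 0) = x ∧ f (gen 1) = y ∧ f (gen 2) = z := by
  have h : ∀ r ∈ g0Rels, FreeGroup.lift ![x, y, z] r = 1 := by
    rintro r (rfl | rfl)
    · simpa using hxy
    · simpa using hyz
  exact ⟨PresentedGroup.toGroup h, PresentedGroup.toGroup.of h, PresentedGroup.toGroup.of h,
    PresentedGroup.toGroup.of h⟩

theorem hom_ext {f g : G0 →* K} (h0 : f (gen 0) = g (gen 0)) (h1 : f (gen 1) = g (gen 1))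
    (h2 : f (gen 2) = g (gen 2)) : f = g := by
  refine PresentedGroup.ext (rels := g0Rels) fun i => ?_
  fin_cases i
  exacts [h0, h1, h2]

end G0

namespace Higman

/-- The generators `a, b, c, d` of Higman's group. -/
def gen (i : Fin 4) : Higman := PresentedGroup.of (rels := higmanRels) i

theorem relation (i : Fin 4) :
    gen i ^ (-2 : ℤ) * (gen (i + 1))⁻¹ * gen i * gen (i + 1) = 1 := by
  fin_cases i
  · exact PresentedGroup.one_of_mem (rels := higmanRels) (Or.inl rfl)
  · exact PresentedGroup.one_of_mem (rels := higmanRels) (Or.inr (Or.inl rfl))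
  · exact PresentedGroup.one_of_mem (rels := higmanRels) (Or.inr (Or.inr (Or.inl rfl)))
  · exact PresentedGroup.one_of_mem (rels := higmanRels) (Or.inr (Or.inr (Or.inr rfl)))

variable {K : Type*} [Group K]

theorem exists_hom (k : Fin 4 → K)
    (hk : ∀ i, k i ^ (-2 : ℤ) * (k (i + 1))⁻¹ * k i * k (i + 1) = 1) :
    ∃ f : Higman →* K, ∀ i, f (gen i) = k i := by
  have h : ∀ r ∈ higmanRels, FreeGroup.lift k r = 1 := by
    rintro r (rfl | rfl | rfl | rfl)
    · simpa using hk 0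
    · simpa using hk 1
    · simpa using hk 2
    · simpa using hk 3
  exact ⟨PresentedGroup.toGroup h, fun i => PresentedGroup.toGroup.of h⟩

theorem hom_ext {f g : Higman →* K} (h : ∀ i, f (gen i) = g (gen i)) : f = g :=
  PresentedGroup.ext (rels := higmanRels) h

end Higman

theorem higmanPhi1_of_zero : higmanPhi1 (FreeGroup.of 0) = G0.gen 0 := FreeGroup.lift_apply_of

theorem higmanPhi1_of_one : higmanPhi1 (FreeGroup.of 1) = G0.gen 2 := FreeGroup.lift_apply_of

theorem higmanPhi2_of_zero : higmanPhi2 (FreeGroup.of 0) = G0.gen 2 := FreeGroup.lift_apply_of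

theorem higmanPhi2_of_one : higmanPhi2 (FreeGroup.of 1) = G0.gen 0 := FreeGroup.lift_apply_of

theorem comp_higmanPhi1_eq_comp_higmanPhi2_iff {K : Type*} [Group K] {f g : G0 →* K} :
    f.comp higmanPhi1 = g.comp higmanPhi2 ↔
      f (G0.gen 0) = g (G0.gen 2) ∧ f (G0.gen 2) = g (G0.gen 0) := by
  refine ⟨fun h => ⟨?_, ?_⟩, fun h => ?_⟩
  · rw [← higmanPhi1_of_zero, ← higmanPhi2_of_zero]
    exact DFunLike.congr_fun h _
  · rw [← higmanPhi1_of_one, ← higmanPhi2_of_one]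
    exact DFunLike.congr_fun h _
  ext i
  fin_cases i
  exacts [h.1, h.2]

open Monoid.PushoutI in
theorem higmanPhi1_injective : Function.Injective higmanPhi1 := by
  obtain ⟨f, hx, -, hz⟩ := G0.exists_hom (K := Monoid.PushoutI affineAmalgam)
    (of 0 ratTranslation) (of 0 ratHalving) (of 1 ratHalving)
    (by simpa only [map_mul, map_inv, map_zpow, map_one] using
      congrArg (of (φ := affineAmalgam) 0) ratHalving_conj)
    (by
      have h : of (φ := affineAmalgam) 0 ratHalving = of 1 ratTranslation := by
        simpa [affineAmalgam] using
          (of_apply_eq_base affineAmalgam 0 (Multiplicative.ofAdd 1)).trans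
            (of_apply_eq_base affineAmalgam 1 (Multiplicative.ofAdd 1)).symm
      rw [h]
      simpa only [map_mul, map_inv, map_zpow, map_one] using
        congrArg (of (φ := affineAmalgam) 1) ratHalving_conj)
  have hf : f.comp higmanPhi1 =
      FreeGroup.lift fun i => of (φ := affineAmalgam) i (![ratTranslation, ratHalving] i) := by
    ext i
    rw [FreeGroup.lift_apply_of, MonoidHom.comp_apply]
    fin_cases i
    exacts [(congrArg f higmanPhi1_of_zero).trans hx, (congrArg f higmanPhi1_of_one).trans hz]
  have hinj := freeGroup_lift_of_injective affineAmalgam_injective _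
    zpow_eq_zero_of_mem_range_affineAmalgam
  rw [← hf, MonoidHom.coe_comp] at hinj
  exact hinj.of_comp

theorem higmanPhi2_injective : Function.Injective higmanPhi2 := by
  have h : higmanPhi2 =
      higmanPhi1.comp (FreeGroup.freeGroupCongr (Equiv.swap 0 1)).toMonoidHom := by
    ext i
    fin_cases i
    · exact higmanPhi2_of_zero.trans higmanPhi1_of_one.symm
    · exact higmanPhi2_of_one.trans higmanPhi1_of_zero.symm
  rw [h, MonoidHom.coe_comp]
  exact higmanPhi1_injective.comp (MulEquiv.injective _)

/-- `φ1, φ2 : F2 → G0` are injective and Higman's group is the amalgamated free product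
(pushout in the category of groups) of two copies of `G0` along `φ1` and `φ2`:
`H ≅ G0 *_{F2} G0`. -/
theorem higman_amalgam :
    Function.Injective higmanPhi1 ∧ Function.Injective higmanPhi2 ∧
      ∃ (i1 : G0 →* Higman) (i2 : G0 →* Higman),
        i1.comp higmanPhi1 = i2.comp higmanPhi2 ∧
        ∀ (K : Type) [Group K] (f : G0 →* K) (g : G0 →* K),
          f.comp higmanPhi1 = g.comp higmanPhi2 →
            ∃! h : Higman →* K, h.comp i1 = f ∧ h.comp i2 = g := by
  refine ⟨higmanPhi1_injective, higmanPhi2_injective, ?_⟩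
  obtain ⟨i1, h10, h11, h12⟩ := G0.exists_hom (Higman.gen 0) (Higman.gen 1) (Higman.gen 2)
    (Higman.relation 0) (Higman.relation 1)
  obtain ⟨i2, h20, h21, h22⟩ := G0.exists_hom (Higman.gen 2) (Higman.gen 3) (Higman.gen 0)
    (Higman.relation 2) (Higman.relation 3)
  refine ⟨i1, i2, comp_higmanPhi1_eq_comp_higmanPhi2_iff.2
    ⟨h10.trans h22.symm, h12.trans h20.symm⟩, fun K _ f g hfg => ?_⟩
  obtain ⟨hx, hz⟩ := comp_higmanPhi1_eq_comp_higmanPhi2_iff.1 hfg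
  obtain ⟨h, hh⟩ := Higman.exists_hom
    ![f (G0.gen 0), f (G0.gen 1), f (G0.gen 2), g (G0.gen 1)] (by
      have hf0 := congrArg f G0.relation_zero
      have hf1 := congrArg f G0.relation_one
      have hg0 := congrArg g G0.relation_zero
      have hg1 := congrArg g G0.relation_one
      simp only [map_mul, map_inv, map_zpow, map_one] at hf0 hf1 hg0 hg1
      rw [← hz] at hg0
      rw [← hx] at hg1
      intro i
      fin_cases i
      exacts [hf0, hf1, hg0, hg1])
  refine ⟨h, ⟨G0.hom_ext ?_ ?_ ?_, G0.hom_ext ?_ ?_ ?_⟩, ?_⟩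
  · rw [MonoidHom.comp_apply, h10]; exact hh 0
  · rw [MonoidHom.comp_apply, h11]; exact hh 1
  · rw [MonoidHom.comp_apply, h12]; exact hh 2
  · rw [MonoidHom.comp_apply, h20]; exact (hh 2).trans hz
  · rw [MonoidHom.comp_apply, h21]; exact hh 3
  · rw [MonoidHom.comp_apply, h22]; exact (hh 0).trans hx
  · rintro h' ⟨rfl, rfl⟩
    refine Higman.hom_ext fun i => ?_
    rw [hh]
    fin_cases i
    · exact (congrArg h' h10).symm
    · exact (congrArg h' h11).symm
    · exact (congrArg h' h12).symm
    · exact (congrArg h' h21).symm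
end

section
/- (Magnus' Freiheitssatz.) Let X be a set and let r be a nontrivial cyclically reduced element of the free group F(X). Let x0 ∈ X be a generator that occurs in r. Then the homomorphism F(X ∖ {x0}) → ⟨X ∣ r⟩ induced by the inclusion X ∖ {x0} ↪ X is injective; that is, the images of the generators X ∖ {x0} freely generate a free subgroup of the one-relator group ⟨X ∣ r⟩. -/
namespace Freiheit

open FreeGroup hiding map_mul map_inv map_one norm_mul_le

/-- The retraction of the free group killing the generator `x`. -/
def erase {X : Type} [DecidableEq X] (x : X) : FreeGroup X →* FreeGroup X :=
  FreeGroup.lift fun y => if y = x then 1 else FreeGroup.of y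

/-- `r` has minimal length in its conjugacy class. -/
def IsConjMinimal {X : Type} [DecidableEq X] (r : FreeGroup X) : Prop :=
  ∀ g, r.norm ≤ (g * r * g⁻¹).norm

/-- The conclusion of the Freiheitssatz: the normal closure of `r` meets the subgroup of the
elements avoiding `x` trivially. -/
def IsMagnus {X : Type} [DecidableEq X] (r : FreeGroup X) (x : X) : Prop :=
  ∀ w, erase x w = w → w ∈ Subgroup.normalClosure {r} → w = 1

section Words

variable {X : Type}

theorem map_mk_cons {G : Type*} [Group G] (f : FreeGroup X →* G) (a : X × Bool)
    (L : List (X × Bool)) :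
    f (mk (a :: L)) = (if a.2 then f (of a.1) else (f (of a.1))⁻¹) * f (mk L) := by
  have : mk (a :: L) = mk [a] * mk L := by simp
  rw [this, map_mul]
  rcases a with ⟨a, _ | _⟩
  · have : mk [(a, false)] = (of a)⁻¹ := by simp [of, invRev]
    simp [this]
  · simp [of]

theorem isReduced_flatMap_replicate {n : X → ℕ} (hn : ∀ x, n x ≠ 0) {L : List (X × Bool)}
    (hL : FreeGroup.IsReduced L) :
    FreeGroup.IsReduced (L.flatMap fun a => List.replicate (n a.1) a) := by
  rw [FreeGroup.IsReduced, List.flatMap_def, List.isChain_flatten (by simp [hn])]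
  constructor
  · simp only [List.mem_map]
    rintro _ ⟨a, -, rfl⟩
    exact List.isChain_replicate_of_rel _ fun _ => rfl
  · rw [List.isChain_map]
    refine hL.imp fun a b hab => ?_
    intro x hx y hy
    rw [Option.mem_def, List.getLast?_replicate, if_neg (hn _)] at hx
    rw [Option.mem_def, List.head?_replicate, if_neg (hn _)] at hy
    simp_all

theorem lift_pow_mk (n : X → ℕ) (L : List (X × Bool)) :
    FreeGroup.lift (fun x => of x ^ n x) (mk L) =
      mk (L.flatMap fun a => List.replicate (n a.1) a) := by
  induction L with
  | nil => simp [← one_eq_mk]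
  | cons a L ih =>
    rw [map_mk_cons, ih, List.flatMap_cons, ← mul_mk]
    congr 1
    have h (b : Bool) (k : ℕ) : mk (List.replicate k (a.1, b)) = mk [(a.1, b)] ^ k := by
      rw [pow_mk]; simp
    rcases a with ⟨a, _ | _⟩
    · have : (of a)⁻¹ = mk [(a, false)] := by simp [of, invRev]
      simp only [h, ← this, lift_apply_of, Bool.false_eq_true, if_false, inv_pow]
    · have : of a = mk [(a, true)] := rfl
      simp only [h, ← this, lift_apply_of, if_true]

variable [DecidableEq X]

theorem erase_of_self (x : X) : erase x (of x) = 1 := by simp [erase]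

theorem erase_of_ne {x y : X} (h : y ≠ x) : erase x (of y) = of y := by simp [erase, h]

theorem erase_erase (x : X) (w : FreeGroup X) : erase x (erase x w) = erase x w := by
  have : (erase x).comp (erase x) = erase x := by
    ext y
    by_cases h : y = x <;> simp [erase, h]
  exact DFunLike.congr_fun this w

theorem hom_congr_of_occursIn {G : Type*} [Group G] {f g : FreeGroup X →* G} {w : FreeGroup X}
    (h : ∀ x, OccursIn x w → f (of x) = g (of x)) : f w = g w := by
  suffices ∀ L : List (X × Bool), (∀ a ∈ L, f (of a.1) = g (of a.1)) → f (mk L) = g (mk L) by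
    rw [← mk_toWord (x := w)]
    exact this w.toWord fun a ha => h a.1 ⟨a.2, ha⟩
  intro L hL
  induction L with
  | nil => simp [← one_eq_mk]
  | cons a L ih =>
    rw [map_mk_cons, map_mk_cons, hL a (by simp), ih fun b hb => hL b (by simp [hb])]

/-- Two homomorphisms agreeing on the generators other than `x` agree on the elements
avoiding `x`. -/
theorem hom_congr_of_erase {G : Type*} [Group G] {f g : FreeGroup X →* G} {x : X}
    {w : FreeGroup X} (hw : erase x w = w) (h : ∀ y, y ≠ x → f (of y) = g (of y)) :
    f w = g w := by
  have : f.comp (erase x) = g.comp (erase x) := by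
    ext y
    by_cases hy : y = x
    · simp [erase, hy]
    · simpa [erase, hy] using h y hy
  rw [← hw]
  exact DFunLike.congr_fun this w

theorem erase_eq_self {x : X} {w : FreeGroup X} (h : ¬ OccursIn x w) : erase x w = w :=
  hom_congr_of_occursIn (g := MonoidHom.id _) fun y hy => by
    rw [erase_of_ne (by rintro rfl; exact h hy), MonoidHom.id_apply]

theorem norm_erase_mk_le (x : X) (L : List (X × Bool)) :
    (erase x (mk L)).norm ≤ L.countP (fun a => a.1 ≠ x) := by
  induction L with
  | nil => simp [← one_eq_mk]
  | cons a L ih =>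
    rw [map_mk_cons, List.countP_cons]
    refine (FreeGroup.norm_mul_le _ _).trans ?_
    by_cases h : a.1 = x
    · subst h
      rw [erase_of_self]
      simpa using ih
    · rw [erase_of_ne h]
      have : (if a.2 = true then of a.1 else (of a.1)⁻¹).norm ≤ 1 := by split_ifs <;> simp
      simp only [ne_eq, h, not_false_eq_true, decide_true, if_true]
      simp only [ne_eq] at ih
      omega

theorem countP_lt_norm {x : X} {w : FreeGroup X} (h : OccursIn x w) :
    w.toWord.countP (fun a => a.1 ≠ x) < w.norm := by
  obtain ⟨b, hb⟩ := h
  rw [FreeGroup.norm]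
  refine lt_of_le_of_ne List.countP_le_length fun he => ?_
  simpa using List.countP_eq_length.1 he _ hb

theorem norm_erase_lt {x : X} {w : FreeGroup X} (h : OccursIn x w) :
    (erase x w).norm < w.norm := by
  have := norm_erase_mk_le x w.toWord
  rw [mk_toWord] at this
  exact this.trans_lt (countP_lt_norm h)

theorem IsConjMinimal.erase_conj_ne {r : FreeGroup X} (hr : IsConjMinimal r) {x : X}
    (hx : OccursIn x r) (g : FreeGroup X) : erase x (g * r * g⁻¹) ≠ g * r * g⁻¹ := by
  intro h
  have h1 : (g⁻¹ * erase x g) * erase x r * (g⁻¹ * erase x g)⁻¹ = r := by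
    simp only [map_mul, map_inv] at h
    simp only [mul_inv_rev, inv_inv]
    calc _ = g⁻¹ * (erase x g * erase x r * (erase x g)⁻¹) * g := by group
      _ = _ := by rw [h]; group
  have h2 := hr (g⁻¹ * erase x g)⁻¹
  have h3 : (g⁻¹ * erase x g)⁻¹ * r * (g⁻¹ * erase x g)⁻¹⁻¹ = erase x r := by
    conv_lhs => rw [← h1]
    group
  rw [h3] at h2
  exact (norm_erase_lt hx).not_ge h2

theorem exists_isConjMinimal (r : FreeGroup X) :
    ∃ g, IsConjMinimal (g * r * g⁻¹) ∧ (g * r * g⁻¹).norm ≤ r.norm := by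
  obtain ⟨g, hg⟩ : ∃ g, ∀ h, (g * r * g⁻¹).norm ≤ (h * r * h⁻¹).norm :=
    ⟨Function.argmin fun g : FreeGroup X => (g * r * g⁻¹).norm,
      fun h => Function.argmin_le (fun g : FreeGroup X => (g * r * g⁻¹).norm) h⟩
  refine ⟨g, fun h => ?_, by simpa using hg 1⟩
  simpa [mul_assoc] using hg (h * g)

theorem norm_pow_of_isCyclicallyReduced {r : FreeGroup X}
    (hr : FreeGroup.IsCyclicallyReduced r.toWord) (n : ℕ) : (r ^ n).norm = n * r.norm := by
  rw [FreeGroup.norm, toWord_pow, (hr.flatten_replicate n).isReduced.reduce_eq]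
  simp [FreeGroup.norm]

theorem isConjMinimal_of_isCyclicallyReduced {r : FreeGroup X}
    (hr : FreeGroup.IsCyclicallyReduced r.toWord) : IsConjMinimal r := by
  intro g
  by_contra! hlt
  set s := g * r * g⁻¹ with hs
  set n := 2 * g.norm + 1
  have h1 : r ^ n = g⁻¹ * s ^ n * g := by
    rw [hs, conj_pow]
    group
  have h2 : (s ^ n).norm ≤ n * s.norm := by
    generalize n = k
    induction k with
    | zero => simp
    | succ k ih =>
      rw [pow_succ, add_mul, one_mul]
      exact (FreeGroup.norm_mul_le _ _).trans (by omega)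
  have h3 : (r ^ n).norm ≤ g.norm + n * s.norm + g.norm := by
    rw [h1]
    have := FreeGroup.norm_mul_le (g⁻¹ * s ^ n) g
    have := FreeGroup.norm_mul_le g⁻¹ (s ^ n)
    rw [norm_inv_eq] at this
    omega
  rw [norm_pow_of_isCyclicallyReduced hr] at h3
  have h4 : n * (s.norm + 1) ≤ n * r.norm := Nat.mul_le_mul_left _ hlt
  rw [mul_add] at h4
  omega

theorem lift_pow_injective {n : X → ℕ} (hn : ∀ x, n x ≠ 0) :
    Function.Injective (FreeGroup.lift fun x => of x ^ n x : FreeGroup X →* FreeGroup X) := by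
  rw [injective_iff_map_eq_one]
  intro w hw
  rw [← mk_toWord (x := w), lift_pow_mk] at hw
  have h := congrArg toWord hw
  rw [toWord_mk, (isReduced_flatMap_replicate hn isReduced_toWord).reduce_eq, toWord_one,
    List.flatMap_eq_nil_iff] at h
  rw [← toWord_eq_nil_iff, List.eq_nil_iff_forall_not_mem]
  intro a ha
  simpa [hn] using h a ha

end Words

section Embedding

variable {X : Type} [DecidableEq X]

theorem IsMagnus.injective_comp_map {r : FreeGroup X} {x : X} (hr : IsMagnus r x) {S : Type}
    {e : S → X} (he : Function.Injective e) (hx : ∀ a, e a ≠ x) :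
    Function.Injective ((PresentedGroup.mk {r}).comp (FreeGroup.map e)) := by
  rw [injective_iff_map_eq_one]
  intro u hu
  rw [MonoidHom.comp_apply, PresentedGroup.mk_eq_one_iff] at hu
  have h : (erase x).comp (FreeGroup.map e) = FreeGroup.map e := by
    ext a
    simp [erase_of_ne (hx a)]
  exact map_injective he (by rw [map_one]; exact hr _ (DFunLike.congr_fun h u) hu)

theorem isMagnus_of_hom {G : Type*} [Group G] {r : FreeGroup X} {x : X} (f : FreeGroup X →* G)
    (hr : f r = 1) (hf : ∀ w, erase x w = w → f w = 1 → w = 1) : IsMagnus r x := by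
  intro w hw hwr
  refine hf w hw (MonoidHom.mem_ker.1 ?_)
  exact Subgroup.normalClosure_le_normal (N := f.ker) (by simpa using hr) hwr

/-- Two embeddings of `K` into `H` become conjugate in an overgroup of `H`. -/
theorem exists_conj_of_injective {H K : Type} [Group H] [Group K] {f g : K →* H}
    (hf : Function.Injective f) (hg : Function.Injective g) :
    ∃ (G : Type) (_ : Group G) (j : H →* G) (T : G) (q : G →* Multiplicative ℤ),
      Function.Injective j ∧ (∀ k, T * j (f k) * T⁻¹ = j (g k)) ∧
        q T = Multiplicative.ofAdd 1 ∧ ∀ h, q (j h) = 1 := by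
  let φ : f.range ≃* g.range := (MonoidHom.ofInjective hf).symm.trans (MonoidHom.ofInjective hg)
  refine ⟨HNNExtension H f.range g.range φ, inferInstance, HNNExtension.of, HNNExtension.t,
    HNNExtension.lift 1 (Multiplicative.ofAdd 1) (by simp), HNNExtension.of_injective φ,
    fun k => ?_, by simp, by simp⟩
  have h := HNNExtension.equiv_eq_conj (φ := φ) ⟨f k, k, rfl⟩
  rw [← h]
  congr 1
  have : (MonoidHom.ofInjective hf).symm ⟨f k, k, rfl⟩ = k :=
    (MonoidHom.ofInjective hf).symm_apply_eq.2 (Subtype.ext rfl)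
  simp only [φ, MulEquiv.trans_apply, this]
  rfl

end Embedding

section Spread

open SemidirectProduct Multiplicative

/-- The integers acting on the free group on `X × ℤ` by translating the indices. -/
def shift (X : Type) : Multiplicative ℤ →* MulAut (FreeGroup (X × ℤ)) where
  toFun n := freeGroupCongr ((Equiv.refl X).prodCongr (Equiv.addRight n.toAdd))
  map_one' := by
    ext w
    simp [freeGroupCongr]
  map_mul' m n := by
    refine MulEquiv.toMonoidHom_injective (FreeGroup.ext_hom _ _ fun x => ?_)
    rcases x with ⟨x, i⟩
    simp [freeGroupCongr, add_comm, add_left_comm]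

/-- The free group on `X × ℤ` extended by the translation of the indices. -/
abbrev ShiftGroup (X : Type) : Type := FreeGroup (X × ℤ) ⋊[shift X] Multiplicative ℤ

variable {X : Type}

theorem shift_of (n : Multiplicative ℤ) (x : X) (i : ℤ) :
    shift X n (of (x, i)) = of (x, i + n.toAdd) := by simp [shift, freeGroupCongr]

theorem inr_conj_of (n i : ℤ) (x : X) :
    (inr (ofAdd n) * inl (of (x, i)) * inr (ofAdd (-n)) : ShiftGroup X) = inl (of (x, i + n)) := by
  rw [ofAdd_neg, ← inl_aut, shift_of, toAdd_ofAdd]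

section Lift

variable {G : Type*} [Group G]

/-- The homomorphism on `ShiftGroup X` sending the translation to `T` and the generator `(x, i)`
to the conjugate of `a x` by `T ^ i`. -/
def shiftLift (T : G) (a : X → G) : ShiftGroup X →* G :=
  SemidirectProduct.lift (FreeGroup.lift fun p => T ^ p.2 * a p.1 * (T ^ p.2)⁻¹) (zpowersHom G T)
    fun n => FreeGroup.ext_hom _ _ fun p => by
      rcases p with ⟨x, i⟩
      simp only [MonoidHom.comp_apply, MulEquiv.coe_toMonoidHom, shift_of, lift_apply_of,
        zpowersHom_apply, MulAut.conj_apply, add_comm i, zpow_add]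
      group

theorem shiftLift_inl_of (T : G) (a : X → G) (x : X) (i : ℤ) :
    shiftLift T a (inl (of (x, i))) = T ^ i * a x * (T ^ i)⁻¹ := by
  simp [shiftLift]

theorem shiftLift_inr (T : G) (a : X → G) (n : ℤ) :
    shiftLift T a (inr (ofAdd n)) = T ^ n := by
  simp [shiftLift]

theorem shiftGroup_hom_ext {f g : ShiftGroup X →* G}
    (h : ∀ x i, f (inl (of (x, i))) = g (inl (of (x, i))))
    (h' : f (inr (ofAdd 1)) = g (inr (ofAdd 1))) : f = g := by
  refine SemidirectProduct.hom_ext (FreeGroup.ext_hom _ _ fun p => h p.1 p.2) ?_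
  ext
  exact h'

end Lift

variable [DecidableEq X]

theorem norm_shift_le (n : Multiplicative ℤ) (w : FreeGroup (X × ℤ)) :
    (shift X n w).norm ≤ w.norm := by
  conv_lhs => rw [← mk_toWord (x := w)]
  exact norm_mk_le.trans (by simp [FreeGroup.norm])

/-- The homomorphism sending `t` to the translation by `e t` and any other generator `x` to
`(x, 0)` followed by the translation by `e x`. -/
def spread (t : X) (e : X → ℤ) : FreeGroup X →* ShiftGroup X :=
  FreeGroup.lift fun x => (if x = t then 1 else inl (of (x, 0))) * inr (ofAdd (e x))

theorem spread_of_self (t : X) (e : X → ℤ) : spread t e (of t) = inr (ofAdd (e t)) := by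
  simp [spread]

theorem spread_of_ne {t x : X} (h : x ≠ t) (e : X → ℤ) :
    spread t e (of x) = inl (of (x, 0)) * inr (ofAdd (e x)) := by
  simp [spread, h]

theorem norm_left_spread_mk_le (t : X) (e : X → ℤ) (L : List (X × Bool)) :
    (spread t e (mk L)).left.norm ≤ L.countP (fun a => a.1 ≠ t) := by
  induction L with
  | nil => simp [← one_eq_mk]
  | cons a L ih =>
    rw [map_mk_cons, mul_left, List.countP_cons]
    refine (FreeGroup.norm_mul_le _ _).trans ?_
    have h1 := (norm_shift_le (if a.2 then spread t e (of a.1) else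
      (spread t e (of a.1))⁻¹).right (spread t e (mk L)).left).trans ih
    rw [add_comm]
    refine add_le_add h1 ?_
    by_cases h : a.1 = t
    · rw [h, spread_of_self]
      split_ifs <;> simp_all
    · rw [spread_of_ne h]
      simp only [ne_eq, h, not_false_eq_true, decide_true, if_true]
      split_ifs
      · simp
      · rw [inv_left]
        refine (norm_shift_le _ _).trans ?_
        simp

/-- The homomorphism sending the translation to `t`, the generators `(t, i)` to `1`, and any other
generator `(x, i)` to the conjugate of `x` by `t ^ i`. -/
def gather (t : X) : ShiftGroup X →* FreeGroup X :=
  shiftLift (of t) fun x => erase t (of x)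

theorem gather_spread_of (t : X) (e : X → ℤ) (x : X) :
    gather t (spread t e (of x)) = erase t (of x) * of t ^ e x := by
  by_cases h : x = t
  · subst h
    rw [spread_of_self, gather, shiftLift_inr, erase_of_self, one_mul]
  · rw [spread_of_ne h, gather, map_mul, shiftLift_inr, shiftLift_inl_of]
    simp

end Spread

section Step

open SemidirectProduct Multiplicative

variable {X : Type} [DecidableEq X]

theorem exists_min_max {s : FreeGroup (X × ℤ)} {c : X} (hc : ∃ i, OccursIn (c, i) s) :
    ∃ m M : ℤ, OccursIn (c, m) s ∧ OccursIn (c, M) s ∧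
      ∀ i, OccursIn (c, i) s → m ≤ i ∧ i ≤ M := by
  have hfin : {i : ℤ | OccursIn (c, i) s}.Finite := by
    refine ((s.toWord.map fun a => a.1.2).toFinset.finite_toSet).subset ?_
    rintro i ⟨b, hb⟩
    simp only [List.coe_toFinset, List.mem_map, Set.mem_ofPred_eq]
    exact ⟨_, hb, rfl⟩
  obtain ⟨m, hm, hm'⟩ := Set.exists_min_image _ id hfin hc
  obtain ⟨M, hM, hM'⟩ := Set.exists_max_image _ id hfin hc
  exact ⟨m, M, hm, hM, fun i hi => ⟨hm' i hi, hM' i hi⟩⟩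

/-- If `s` satisfies the conclusion of the Freiheitssatz for the extreme letters `(c, m)` and
`(c, M)`, then the one-relator group of `s` embeds in a group in which the translations of the
indices are induced by conjugation by a single element, apart from the letters `(c, i)` with `i`
outside of `[m, M]`. -/
theorem exists_hom_shiftGroup {s : FreeGroup (X × ℤ)} {c : X} {m M : ℤ} (hmM : m ≤ M)
    (hm : IsMagnus s (c, m)) (hM : IsMagnus s (c, M))
    (hs : ∀ i, OccursIn (c, i) s → m ≤ i ∧ i ≤ M) :
    ∃ (G : Type) (_ : Group G) (j : PresentedGroup {s} →* G) (Θ : ShiftGroup X →* G)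
      (q : G →* Multiplicative ℤ), Function.Injective j ∧ (∀ v, q (Θ v) = v.right) ∧
      (∀ x i, x ≠ c ∨ m ≤ i ∧ i ≤ M → Θ (inl (of (x, i))) = j (PresentedGroup.of (x, i))) ∧
      Θ (inl s) = 1 := by
  let S : Type := {p : X × ℤ // p.1 ≠ c ∨ m ≤ p.2 ∧ p.2 < M}
  have hA := hM.injective_comp_map (S := S) (e := Subtype.val) Subtype.val_injective
    (fun ⟨p, hp⟩ => by rintro rfl; simp at hp)
  have hB := hm.injective_comp_map (S := S) (e := fun p => (p.1.1, p.1.2 + 1))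
    (fun ⟨⟨x, i⟩, _⟩ ⟨⟨y, k⟩, _⟩ h => Subtype.ext (by simpa using h))
    (fun ⟨⟨x, i⟩, hp⟩ => by
      rintro h
      simp only [Prod.mk.injEq] at h
      simp only at hp
      rcases hp with hp | hp
      · exact hp h.1
      · omega)
  obtain ⟨G, _, j, T, q, hj, hT, hqT, hqj⟩ := exists_conj_of_injective hA hB
  let a : X × ℤ → G := fun p => j (PresentedGroup.of p)
  have ha (x : X) (i : ℤ) (h : x ≠ c ∨ m ≤ i ∧ i < M) : T * a (x, i) * T⁻¹ = a (x, i + 1) := by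
    simpa [a, PresentedGroup.of] using hT (of ⟨(x, i), h⟩)
  let Θ : ShiftGroup X →* G := shiftLift T fun x => T ^ (-m) * a (x, m) * T ^ m
  have hΘ (x : X) (i : ℤ) : Θ (inl (of (x, i))) = T ^ (i - m) * a (x, m) * (T ^ (i - m))⁻¹ := by
    simp only [Θ, shiftLift_inl_of]
    group
  have hstep (x : X) (i : ℤ) : Θ (inl (of (x, i + 1))) = T * Θ (inl (of (x, i))) * T⁻¹ := by
    rw [hΘ, hΘ]
    group
  have key (x : X) (i : ℤ) (h : x ≠ c ∨ m ≤ i ∧ i ≤ M) : Θ (inl (of (x, i))) = a (x, i) := by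
    have hup : ∀ i, m ≤ i → (x ≠ c ∨ i ≤ M) → Θ (inl (of (x, i))) = a (x, i) := by
      intro i hi
      induction i, hi using Int.leInduction with
      | base => simp [hΘ]
      | succ i hi ih =>
        intro h
        rw [hstep, ih (h.imp_right (by omega)), ha _ _ (h.imp_right (by omega))]
    rcases le_total m i with hi | hi
    · exact hup i hi (h.imp_right (by omega))
    · by_cases hx : x = c
      · have : i = m := by
          rcases h with h | h
          · exact absurd hx h
          · omega
        subst this
        exact hup i le_rfl (.inr hmM)
      · induction i, hi using Int.leInductionDown with
        | base => simp [hΘ]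
        | pred i hi ih =>
          have h1 := hstep x (i - 1)
          have h2 := ha x (i - 1) (.inl hx)
          rw [sub_add_cancel] at h1 h2
          rw [ih (.inl hx), ← h2] at h1
          exact (mul_left_cancel (mul_right_cancel h1)).symm
  refine ⟨G, _, j, Θ, q, hj, fun v => ?_, key, ?_⟩
  · have : q.comp Θ = rightHom := by
      refine shiftGroup_hom_ext (fun x i => ?_) ?_
      · simp [hΘ, a, hqj]
      · simp [Θ, shiftLift_inr, hqT]
    exact DFunLike.congr_fun this v
  · have h1 : Θ.comp inl s = (j.comp (PresentedGroup.mk {s})) s := by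
      refine hom_congr_of_occursIn fun ⟨x, i⟩ hx => ?_
      refine key x i ?_
      by_cases h : x = c
      · subst h
        exact .inr (hs i hx)
      · exact .inl h
    have h2 : PresentedGroup.mk {s} s = 1 := PresentedGroup.one_of_mem rfl
    simpa [h2] using h1

/-- The exponent sum of the generator `x`. -/
def expSum (x : X) : FreeGroup X →* Multiplicative ℤ :=
  FreeGroup.lift fun y => if y = x then ofAdd 1 else 1

theorem isMagnus_of_expSum_ne_one {r : FreeGroup X} {b t : X} (hbt : b ≠ t)
    (hb : expSum b r ≠ 1) (ht : OccursIn t r)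
    (ih : ∀ s : FreeGroup (X × ℤ), s.norm < r.norm → IsConjMinimal s →
      ∀ z, OccursIn z s → IsMagnus s z) : IsMagnus r b := by
  obtain ⟨β, hβ⟩ := ofAdd.surjective (expSum b r)
  obtain ⟨α, hα⟩ := ofAdd.surjective (expSum t r)
  have hβ0 : β ≠ 0 := by
    rintro rfl
    exact hb hβ.symm
  let e : X → ℤ := fun x => if x = t then β.natAbs else if x = b then -(α * β.sign) else 0
  let ψ := spread t e
  have hright : (ψ r).right = 1 := by
    have h : rightHom.comp ψ = expSum t ^ (β.natAbs : ℤ) * expSum b ^ (-(α * β.sign)) := by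
      ext x
      by_cases hx : x = t
      · subst hx
        rw [MonoidHom.comp_apply, MonoidHom.mul_apply, MonoidHom.zpow_apply, MonoidHom.zpow_apply,
          spread_of_self, rightHom_inr, expSum, expSum, lift_apply_of, lift_apply_of, if_pos rfl,
          if_neg hbt.symm, one_zpow, mul_one, ← ofAdd_zsmul, smul_eq_mul, mul_one]
        simp only [e, if_true]
      · by_cases hx' : x = b
        · subst hx'
          rw [MonoidHom.comp_apply, MonoidHom.mul_apply, MonoidHom.zpow_apply,
            MonoidHom.zpow_apply, spread_of_ne hx, map_mul, rightHom_inl, rightHom_inr, expSum,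
            expSum, lift_apply_of, lift_apply_of, if_pos rfl, if_neg hx, one_zpow,
            ← ofAdd_zsmul, smul_eq_mul, mul_one]
          simp only [e, if_neg hx, if_true]
        · simp [ψ, spread_of_ne hx, expSum, e, hx, hx']
    have h1 := DFunLike.congr_fun h r
    rw [MonoidHom.mul_apply, MonoidHom.zpow_apply, MonoidHom.zpow_apply, ← hα, ← hβ,
      ← ofAdd_zsmul, ← ofAdd_zsmul, ← ofAdd_add] at h1
    refine h1.trans (ofAdd_eq_one.2 ?_)
    simp only [smul_eq_mul, ← Int.sign_mul_self_eq_natAbs]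
    ring
  have hψr : ψ r = inl (ψ r).left := by
    ext <;> simp [hright]
  obtain ⟨g, hmin, hnorm⟩ := exists_isConjMinimal (ψ r).left
  set s := g * (ψ r).left * g⁻¹ with hs
  have hlt : s.norm < r.norm := by
    refine hnorm.trans_lt (lt_of_le_of_lt ?_ (countP_lt_norm ht))
    simpa only [mk_toWord] using norm_left_spread_mk_le t e r.toWord
  have hbs : ∃ i, OccursIn (b, i) s := by
    by_contra! hno
    let σ : ShiftGroup X →* Multiplicative ℤ := shiftLift 1 fun x => if x = b then ofAdd 1 else 1
    have h1 : σ.comp ψ = expSum b := by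
      ext x
      by_cases hx : x = t
      · subst hx
        simp [ψ, spread_of_self, expSum, σ, hbt.symm, shiftLift_inr]
      · simp [ψ, spread_of_ne hx, expSum, σ, shiftLift_inr, shiftLift_inl_of]
    have h2 : σ.comp inl s = (1 : FreeGroup (X × ℤ) →* Multiplicative ℤ) s := by
      refine hom_congr_of_occursIn fun ⟨x, i⟩ hx => ?_
      have : x ≠ b := by
        rintro rfl
        exact hno i hx
      simp [σ, shiftLift_inl_of, this]
    have h3 : σ (ψ r) = 1 := by
      rw [hψr]
      simpa [hs] using h2
    exact hb ((DFunLike.congr_fun h1 r).symm.trans h3)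
  obtain ⟨m, M, hm, hM, hmM⟩ := exists_min_max hbs
  have hMagnus := ih s hlt hmin
  obtain ⟨G, _, j, Θ, q, hj, hq, hΘ, hΘs⟩ :=
    exists_hom_shiftGroup (hmM M hM).1 (hMagnus _ hm) (hMagnus _ hM) hmM
  refine isMagnus_of_hom (Θ.comp ψ) ?_ fun w hw hfw => ?_
  · rw [MonoidHom.comp_apply, hψr]
    simpa [hs] using hΘs
  · rw [MonoidHom.comp_apply] at hfw
    have hψw : ψ w = inl (ψ w).left := by
      have : (ψ w).right = 1 := by rw [← hq, hfw, map_one]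
      ext <;> simp [this]
    let κ : FreeGroup (X × ℤ) →* FreeGroup (X × ℤ) :=
      FreeGroup.lift fun p => if p.1 = b then 1 else of p
    let K : ShiftGroup X →* ShiftGroup X :=
      shiftLift (inr (ofAdd 1)) fun x => if x = b then 1 else inl (of (x, 0))
    have hK (u) : K (inl u) = inl (κ u) := by
      have : K.comp inl = inl.comp κ := by
        refine FreeGroup.ext_hom _ _ fun ⟨x, i⟩ => ?_
        by_cases hx : x = b
        · simp [K, κ, shiftLift_inl_of, hx]
        · have h := inr_conj_of i 0 x
          rw [zero_add, ofAdd_neg, map_inv] at h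
          simpa [K, κ, shiftLift_inl_of, hx, ← map_zpow, ← ofAdd_zsmul] using h
      exact DFunLike.congr_fun this u
    have hKψ : K (ψ w) = ψ w := by
      refine hom_congr_of_erase (f := K.comp ψ) hw fun x hx => ?_
      have hKr (n : ℤ) : K (inr (ofAdd n)) = inr (ofAdd n) := by
        simp [K, shiftLift_inr, ← map_zpow, ← ofAdd_zsmul]
      by_cases hxt : x = t
      · rw [hxt, MonoidHom.comp_apply, spread_of_self, hKr]
      · rw [MonoidHom.comp_apply, spread_of_ne hxt, map_mul, hKr, hK]
        simp [κ, hx]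
    set u := (ψ w).left with hu
    have hκ : κ u = u := by
      rw [hψw, hK] at hKψ
      exact inl_injective hKψ
    have h1 : erase (b, M) u = u := by
      have h : (erase (b, M)).comp κ = κ := by
        ext ⟨x, i⟩
        by_cases hx : x = b
        · simp [κ, hx]
        · simp [κ, hx, erase]
      rw [← hκ]
      exact DFunLike.congr_fun h u
    have h2 : Θ (inl u) = j (PresentedGroup.mk {s} u) := by
      have h : (Θ.comp inl).comp κ = (j.comp (PresentedGroup.mk {s})).comp κ := by
        refine FreeGroup.ext_hom _ _ fun ⟨x, i⟩ => ?_
        by_cases hx : x = b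
        · simp [κ, hx]
        · simpa [κ, hx, PresentedGroup.of] using hΘ x i (.inl hx)
      rw [← hκ]
      exact DFunLike.congr_fun h u
    rw [hψw, h2] at hfw
    have h3 := (injective_iff_map_eq_one j).1 hj _ hfw
    have h4 : u = 1 := hMagnus _ hM u h1 (PresentedGroup.mk_eq_one_iff.1 h3)
    let n : X → ℕ := fun x => if x = t then β.natAbs else 1
    refine (injective_iff_map_eq_one _).1 (lift_pow_injective (n := n) fun x => ?_) w ?_
    · by_cases hx : x = t <;> simp [n, hx, hβ0]
    · have h5 : ((gather t).comp ψ) w = FreeGroup.lift (fun x => of x ^ n x) w := by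
        refine hom_congr_of_erase hw fun x hx => ?_
        rw [MonoidHom.comp_apply, gather_spread_of]
        by_cases hxt : x = t
        · subst hxt
          simp only [erase_of_self, one_mul, e, if_true, n, lift_apply_of, zpow_natCast]
        · simp [erase_of_ne hxt, e, n, hx, hxt]
      rw [← h5, MonoidHom.comp_apply, hψw, h4, map_one, map_one]

theorem isMagnus_of_expSum_eq_one {r : FreeGroup X} {b : X} (hr : IsConjMinimal r)
    (hb : OccursIn b r) (hb1 : expSum b r = 1)
    (ih : ∀ s : FreeGroup (X × ℤ), s.norm < r.norm → IsConjMinimal s →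
      ∀ z, OccursIn z s → IsMagnus s z) : IsMagnus r b := by
  let e : X → ℤ := fun x => if x = b then 1 else 0
  let ψ := spread b e
  have hgather (w) : gather b (ψ w) = w := by
    have : (gather b).comp ψ = MonoidHom.id _ := by
      ext x
      rw [MonoidHom.comp_apply, gather_spread_of]
      by_cases hx : x = b
      · subst hx
        simp [erase_of_self, e]
      · simp [erase_of_ne hx, e, hx]
    exact DFunLike.congr_fun this w
  have hright : (ψ r).right = 1 := by
    have h : rightHom.comp ψ = expSum b := by
      ext x
      by_cases hx : x = b
      · subst hx
        simp [ψ, spread_of_self, expSum, e]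
      · simp [ψ, spread_of_ne hx, expSum, e, hx]
    exact (DFunLike.congr_fun h r).trans hb1
  have hψr : ψ r = inl (ψ r).left := by
    ext <;> simp [hright]
  obtain ⟨g, hmin, hnorm⟩ := exists_isConjMinimal (ψ r).left
  set s := g * (ψ r).left * g⁻¹ with hs
  have hlt : s.norm < r.norm := by
    refine hnorm.trans_lt (lt_of_le_of_lt ?_ (countP_lt_norm hb))
    simpa only [mk_toWord] using norm_left_spread_mk_le b e r.toWord
  have hother (k : ℤ) : ∃ c i, i ≠ k ∧ OccursIn (c, i) s := by
    by_contra! hno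
    set v : FreeGroup X := erase b (FreeGroup.map Prod.fst s) with hv
    have h1 : gather b (inl s) = of b ^ k * v * (of b ^ k)⁻¹ := by
      refine hom_congr_of_occursIn (f := (gather b).comp inl) (g := (MulAut.conj
        (of b ^ k)).toMonoidHom.comp ((erase b).comp (FreeGroup.map Prod.fst)))
        fun ⟨x, i⟩ hx => ?_
      have hik : i = k := by
        by_contra h
        exact hno x i h hx
      simp [gather, shiftLift_inl_of, hik, -map_zpow]
    have h2 : gather b (inl s) = gather b (inl g) * r * (gather b (inl g))⁻¹ := by
      rw [hs, map_mul, map_mul, map_mul, map_mul, ← hψr, hgather, map_inv, map_inv]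
    have h3 : ((of b ^ k)⁻¹ * gather b (inl g)) * r * ((of b ^ k)⁻¹ * gather b (inl g))⁻¹ = v := by
      rw [h2] at h1
      calc _ = (of b ^ k)⁻¹ * (gather b (inl g) * r * (gather b (inl g))⁻¹) * of b ^ k := by group
        _ = _ := by rw [h1]; group
    refine hr.erase_conj_ne hb ((of b ^ k)⁻¹ * gather b (inl g)) ?_
    rw [h3, hv, erase_erase]
  obtain ⟨c, i₀, -, hc⟩ := hother 0
  obtain ⟨m, M, hm, hM, hmM⟩ := exists_min_max ⟨i₀, hc⟩
  have hMagnus := ih s hlt hmin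
  obtain ⟨G, _, j, Θ, q, hj, hq, hΘ, hΘs⟩ :=
    exists_hom_shiftGroup (hmM M hM).1 (hMagnus _ hm) (hMagnus _ hM) hmM
  obtain ⟨d, i, him, hd⟩ := hother m
  refine isMagnus_of_hom (Θ.comp ψ) ?_ fun w hw hfw => ?_
  · rw [MonoidHom.comp_apply, hψr]
    simpa [hs] using hΘs
  · rw [MonoidHom.comp_apply] at hfw
    let T : ShiftGroup X := inr (ofAdd m)
    have h1 : T * ψ w * T⁻¹ = inl (FreeGroup.map (fun x => (x, m)) w) := by
      refine hom_congr_of_erase (f := (MulAut.conj T).toMonoidHom.comp ψ)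
        (g := inl.comp (FreeGroup.map fun x => (x, m))) hw fun x hx => ?_
      have h := inr_conj_of m 0 x
      rw [zero_add, ofAdd_neg, map_inv] at h
      simpa [ψ, spread_of_ne hx, e, hx] using h
    have h2 : Θ (T * ψ w * T⁻¹) =
        j (PresentedGroup.mk {s} (FreeGroup.map (fun x => (x, m)) w)) := by
      rw [h1]
      have : (Θ.comp inl).comp (FreeGroup.map fun x => (x, m)) =
          (j.comp (PresentedGroup.mk {s})).comp (FreeGroup.map fun x => (x, m)) := by
        refine FreeGroup.ext_hom _ _ fun x => ?_
        simpa [PresentedGroup.of] using hΘ x m (.inr ⟨le_rfl, (hmM M hM).1⟩)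
      exact DFunLike.congr_fun this w
    rw [map_mul, map_mul, hfw, mul_one, ← map_mul, mul_inv_cancel, map_one] at h2
    have h3 := (injective_iff_map_eq_one j).1 hj _ h2.symm
    refine (injective_iff_map_eq_one _).1 ((hMagnus _ hd).injective_comp_map
      (e := fun x : X => (x, m)) (fun x y h => congrArg Prod.fst h) fun x h => ?_) w h3
    exact him (congrArg Prod.snd h).symm

end Step

theorem isMagnus_of_isConjMinimal {X : Type} [DecidableEq X] {r : FreeGroup X}
    (hr : IsConjMinimal r) {b : X} (hb : OccursIn b r) : IsMagnus r b := by
  induction hn : r.norm using Nat.strong_induction_on generalizing X with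
  | _ n ih =>
    subst hn
    have ih' : ∀ s : FreeGroup (X × ℤ), s.norm < r.norm → IsConjMinimal s →
        ∀ z, OccursIn z s → IsMagnus s z := fun s hs hmin z hz => ih _ hs hmin hz rfl
    by_cases hb1 : expSum b r = 1
    · exact isMagnus_of_expSum_eq_one hr hb hb1 ih'
    · by_cases ht : ∃ t, b ≠ t ∧ OccursIn t r
      · obtain ⟨t, hbt, ht⟩ := ht
        exact isMagnus_of_expSum_ne_one hbt hb1 ht ih'
      · push Not at ht
        refine isMagnus_of_hom (erase b) ?_ fun w hw hw1 => hw.symm.trans hw1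
        refine hom_congr_of_occursIn (g := 1) fun x hx => ?_
        have : x = b := by
          by_contra h
          exact ht x (Ne.symm h) hx
        simp [this, erase_of_self]

end Freiheit

/-- Magnus' Freiheitssatz: if `r` is a nontrivial cyclically reduced element of the free group
on `X` and `x0` occurs in `r`, then the natural homomorphism from the free group on
`X ∖ {x0}` to the one-relator group `⟨X ∣ r⟩` is injective. -/
theorem freiheitssatz {X : Type} [DecidableEq X] (r : FreeGroup X) (hr : r ≠ 1)
    (hcyc : IsCyclicallyReduced r) (x0 : X) (hx0 : OccursIn x0 r) :
    Function.Injective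
      (FreeGroup.lift (fun y : {x : X // x ≠ x0} =>
        (PresentedGroup.of y.1 : PresentedGroup ({r} : Set (FreeGroup X))))) := by
  have hred : FreeGroup.IsCyclicallyReduced r.toWord := by
    refine ⟨FreeGroup.isReduced_toWord, fun q hq p hp h => ?_⟩
    by_contra hne
    refine hcyc.2 p q hp hq (Prod.ext h.symm ?_)
    exact Bool.eq_not.2 (Ne.symm hne)
  have hM := Freiheit.isMagnus_of_isConjMinimal
    (Freiheit.isConjMinimal_of_isCyclicallyReduced hred) hx0
  have h := hM.injective_comp_map (S := {x : X // x ≠ x0}) Subtype.val_injective Subtype.prop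
  convert h using 2
  ext y
  simp [PresentedGroup.of]
end
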